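/- arXiv:2412.17017 — 5 statements merged into one kernel-verified Lean document; each statement's English description precedes it below -/
import Mathlib

section
/- There exists a constant C > 0 such that for every Schwartz function f : ℝ³ → ℝ one has ‖f‖_{L^∞(ℝ³)} ≤ C ‖∇f‖_{L²(ℝ³)}^{1/2} ‖∇²f‖_{L²(ℝ³)}^{1/2}, where ‖∇f‖_{L²}² = Σ_{|α|=1} ‖∂^α f‖²_{L²} and ‖∇²f‖_{L²}² = Σ_{|α|=2} ‖∂^α f‖²_{L²}. -/
noncomputable section

open MeasureTheory
open scoped ENNReal

/-- The spatial domain `ℝ³`. -/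
abbrev Sp : Type := EuclideanSpace ℝ (Fin 3)

/-- Partial derivative in the `i`-th coordinate direction. -/
def pd (i : Fin 3) (f : Sp → ℝ) : Sp → ℝ :=
  fun x => fderiv ℝ f x (EuclideanSpace.single i 1)

/-- Iterated partial derivative `∂₀^a ∂₁^b ∂₂^c`, i.e. `∂^α` for `α = (a,b,c)`. -/
def mpd (a b c : ℕ) (f : Sp → ℝ) : Sp → ℝ :=
  (pd 0)^[a] ((pd 1)^[b] ((pd 2)^[c] f))

/-- Squared `L²(ℝ³)` norm, valued in `ℝ≥0∞`. -/
def nsq (f : Sp → ℝ) : ℝ≥0∞ := (eLpNorm f 2 volume) ^ 2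

/-- Squared Sobolev `H^m(ℝ³)` norm: `Σ_{|α| ≤ m} ‖∂^α f‖_{L²}²`. -/
def sobSq (m : ℕ) (f : Sp → ℝ) : ℝ≥0∞ :=
  ∑ a ∈ Finset.range (m+1), ∑ b ∈ Finset.range (m+1), ∑ c ∈ Finset.range (m+1),
    if a + b + c ≤ m then nsq (mpd a b c f) else 0

/-- Squared `L²` norm of the collection `∇^m f`: `Σ_{|α| = m} ‖∂^α f‖_{L²}²`. -/
def dmSq (m : ℕ) (f : Sp → ℝ) : ℝ≥0∞ :=
  ∑ a ∈ Finset.range (m+1), ∑ b ∈ Finset.range (m+1), ∑ c ∈ Finset.range (m+1),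
    if a + b + c = m then nsq (mpd a b c f) else 0

/-- Squared `H^m` norm of the gradient `∇f`. -/
def gradSobSq (m : ℕ) (f : Sp → ℝ) : ℝ≥0∞ := ∑ i : Fin 3, sobSq m (pd i f)

open scoped SchwartzMap FourierTransform LineDeriv

/-- The square of the `L²` norm of a Schwartz function is the integral of its square. -/
lemma nsq_schwartz (f : 𝓢(Sp, ℝ)) : nsq f = ENNReal.ofReal (∫ x, ‖f x‖ ^ 2) := by
  have h := (f.memLp 2 volume).eLpNorm_eq_integral_rpow_norm (by simp) (by simp)
  have h0 : 0 ≤ ∫ x, ‖f x‖ ^ 2 := integral_nonneg fun x => by positivity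
  rw [nsq, h, ← ENNReal.ofReal_pow (by positivity)]
  congr 1
  simp only [ENNReal.toReal_ofNat, Real.rpow_two]
  rw [← Real.rpow_natCast, ← Real.rpow_mul h0]
  norm_num

lemma pd_schwartz (i : Fin 3) (f : 𝓢(Sp, ℝ)) :
    pd i f = ∂_{(EuclideanSpace.single i 1 : Sp)} f := rfl

lemma nsq_pd (i : Fin 3) (f : 𝓢(Sp, ℝ)) :
    nsq (pd i f) =
      ENNReal.ofReal (∫ x, ‖(∂_{(EuclideanSpace.single i 1 : Sp)} f) x‖ ^ 2) := by
  rw [pd_schwartz, nsq_schwartz]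

lemma sum_integral_pd_le_dmSq_one (f : 𝓢(Sp, ℝ)) :
    ENNReal.ofReal (∑ i, ∫ x, ‖(∂_{(EuclideanSpace.single i 1 : Sp)} f) x‖ ^ 2) ≤ dmSq 1 f := by
  rw [ENNReal.ofReal_sum_of_nonneg fun i _ => integral_nonneg fun x => by positivity]
  simp only [← nsq_pd]
  simp [dmSq, mpd, Finset.sum_range_succ, Fin.sum_univ_three, add_comm, add_left_comm]

lemma sum_integral_pd_pd_le_dmSq_two (f : 𝓢(Sp, ℝ)) :
    ENNReal.ofReal (∑ i, ∫ x, ‖(∂_{(EuclideanSpace.single i 1 : Sp)}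
      (∂_{(EuclideanSpace.single i 1 : Sp)} f)) x‖ ^ 2) ≤ dmSq 2 f := by
  rw [ENNReal.ofReal_sum_of_nonneg fun i _ => integral_nonneg fun x => by positivity]
  simp only [← nsq_pd]
  simp only [← pd_schwartz]
  calc ∑ i, nsq (pd i (pd i f))
      ≤ ∑ i, nsq (pd i (pd i f)) +
          (nsq (pd 1 (pd 2 f)) + (nsq (pd 0 (pd 2 f)) + nsq (pd 0 (pd 1 f)))) := le_self_add
    _ = dmSq 2 f := by
      simp [dmSq, mpd, Finset.sum_range_succ, Fin.sum_univ_three]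
      ring

/-- The complexification of a real Schwartz function. -/
def complexify (f : 𝓢(Sp, ℝ)) : 𝓢(Sp, ℂ) := f.postcompCLM Complex.ofRealCLM

lemma complexify_apply (f : 𝓢(Sp, ℝ)) (x : Sp) : complexify f x = f x := rfl

lemma lineDeriv_complexify (m : Sp) (f : 𝓢(Sp, ℝ)) :
    ∂_{m} (complexify f) = complexify (∂_{m} f) := by
  ext x
  rw [complexify_apply, SchwartzMap.lineDerivOp_apply_eq_fderiv,
    SchwartzMap.lineDerivOp_apply_eq_fderiv]
  have h := Complex.ofRealCLM.hasFDerivAt.comp x (f.hasFDerivAt x)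
  have h' : HasFDerivAt (complexify f) (Complex.ofRealCLM.comp (fderiv ℝ f x)) x := h
  rw [h'.fderiv]
  rfl

lemma norm_fourier_lineDeriv (g : 𝓢(Sp, ℂ)) (i : Fin 3) (ξ : Sp) :
    ‖𝓕 (∂_{(EuclideanSpace.single i 1 : Sp)} g) ξ‖ = 2 * Real.pi * |ξ i| * ‖𝓕 g ξ‖ := by
  have : (inner ℝ · (EuclideanSpace.single i 1 : Sp)).HasTemperateGrowth := by fun_prop
  rw [SchwartzMap.fourier_lineDerivOp_eq, smul_apply,
    SchwartzMap.smulLeftCLM_apply_apply this]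
  simp [EuclideanSpace.inner_single_right, abs_of_pos Real.pi_pos]
  ring

/-- The `L²` norm of a real Schwartz function, on the Fourier side. -/
lemma integral_norm_sq_fourier_complexify (f : 𝓢(Sp, ℝ)) :
    ∫ ξ, ‖𝓕 (complexify f) ξ‖ ^ 2 = ∫ x, ‖f x‖ ^ 2 := by
  rw [SchwartzMap.integral_norm_sq_fourier]
  simp [complexify_apply]

lemma integrable_norm_sq (g : 𝓢(Sp, ℂ)) : Integrable fun ξ => ‖g ξ‖ ^ 2 :=
  (memLp_two_iff_integrable_sq_norm g.continuous.aestronglyMeasurable).1 (g.memLp 2 volume)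

lemma norm_le_integral_norm_fourier (g : 𝓢(Sp, ℂ)) (x : Sp) : ‖g x‖ ≤ ∫ ξ, ‖𝓕 g ξ‖ := by
  have h : g x = 𝓕 (𝓕 g) (-x) := by
    conv_lhs => rw [← FourierTransform.fourierInv_fourier_eq (F := 𝓢(Sp, ℂ)) g]
    rw [SchwartzMap.fourierInv_apply_eq]
    rfl
  rw [h, ← SchwartzMap.norm_toLp_one]
  exact SchwartzMap.norm_fourier_apply_le_toLp_one _ _

/-- The weight `|η|⁻² (1 + |η|²)⁻¹` on frequency space. -/
def freqWeight (η : Sp) : ℝ := (‖η‖ ^ 2 + ‖η‖ ^ 4)⁻¹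

lemma integrable_freqWeight : Integrable freqWeight := by
  refine (integrable_fun_norm_addHaar (volume : Measure Sp)
    (f := fun r : ℝ => (r ^ 2 + r ^ 4)⁻¹)).2 ?_
  refine (integrable_inv_one_add_sq.integrableOn (s := Set.Ioi 0)).congr_fun ?_ measurableSet_Ioi
  intro r hr
  have hr' : r ≠ 0 := ne_of_gt hr
  have : (1 + r ^ 2) ≠ 0 := by positivity
  have : r ^ 2 + r ^ 4 ≠ 0 := by positivity
  simp only [finrank_euclideanSpace, Fintype.card_fin, smul_eq_mul, Nat.add_one_sub_one]
  field_simp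

lemma integral_freqWeight_comp_smul {l : ℝ} (hl : 0 < l) :
    ∫ ξ, freqWeight (l⁻¹ • ξ) = l ^ 3 * ∫ η, freqWeight η := by
  rw [Measure.integral_comp_smul_of_nonneg _ _ _ (hR := by positivity)]
  simp

lemma le_add_sq_div {y u : ℝ} (hu : 0 < u) : y ≤ u + y ^ 2 / u := by
  rw [← sub_nonneg, show u + y ^ 2 / u - y = (u ^ 2 - u * y + y ^ 2) / u by field_simp; ring]
  exact div_nonneg (by nlinarith [sq_nonneg (u - y), sq_nonneg (u + y)]) hu.le

lemma one_le_two_pi : 1 ≤ 2 * Real.pi := by linarith [Real.pi_gt_three]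

lemma norm_sq_eq_sum_abs_sq (ξ : Sp) : ‖ξ‖ ^ 2 = ∑ i, |ξ i| ^ 2 := by
  simp [EuclideanSpace.norm_sq_eq]

lemma norm_sq_mul_norm_fourier_sq_le (g : 𝓢(Sp, ℂ)) (ξ : Sp) :
    ‖ξ‖ ^ 2 * ‖𝓕 g ξ‖ ^ 2 ≤
      ∑ i, ‖𝓕 (∂_{(EuclideanSpace.single i 1 : Sp)} g) ξ‖ ^ 2 := by
  rw [norm_sq_eq_sum_abs_sq, Finset.sum_mul]
  refine Finset.sum_le_sum fun i _ => ?_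
  rw [norm_fourier_lineDeriv, ← mul_pow]
  gcongr
  exact le_mul_of_one_le_left (abs_nonneg _) one_le_two_pi

lemma norm_pow_four_mul_norm_fourier_sq_le (g : 𝓢(Sp, ℂ)) (ξ : Sp) :
    ‖ξ‖ ^ 4 * ‖𝓕 g ξ‖ ^ 2 ≤ 3 * ∑ i, ‖𝓕 (∂_{(EuclideanSpace.single i 1 : Sp)}
      (∂_{(EuclideanSpace.single i 1 : Sp)} g)) ξ‖ ^ 2 := by
  have h : ‖ξ‖ ^ 4 ≤ 3 * ∑ i, (|ξ i| ^ 2) ^ 2 := by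
    have := sq_sum_le_card_mul_sum_sq (s := Finset.univ) (f := fun i => |ξ i| ^ 2)
    rw [← norm_sq_eq_sum_abs_sq] at this
    calc ‖ξ‖ ^ 4 = (‖ξ‖ ^ 2) ^ 2 := by ring
      _ ≤ _ := by simpa using this
  refine (mul_le_mul_of_nonneg_right h (sq_nonneg _)).trans ?_
  rw [mul_assoc, Finset.sum_mul]
  refine mul_le_mul_of_nonneg_left (Finset.sum_le_sum fun i _ => ?_) (by norm_num)
  rw [norm_fourier_lineDeriv, norm_fourier_lineDeriv, ← mul_pow, ← mul_assoc]
  have hi : |ξ i| ≤ 2 * Real.pi * |ξ i| := le_mul_of_one_le_left (abs_nonneg _) one_le_two_pi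
  rw [sq |ξ i|]
  gcongr

lemma le_weight_add {l s y P Q : ℝ} (hl : 0 < l) (hs : 0 < s) {ξ : Sp} (hξ : ξ ≠ 0)
    (hP : ‖ξ‖ ^ 2 * y ^ 2 ≤ P) (hQ : ‖ξ‖ ^ 4 * y ^ 2 ≤ Q) :
    y ≤ s * freqWeight (l⁻¹ • ξ) + (P / l ^ 2 + Q / l ^ 4) / s := by
  have hn : 0 < ‖ξ‖ := norm_pos_iff.2 hξ
  have hw : freqWeight (l⁻¹ • ξ) = (‖ξ‖ ^ 2 / l ^ 2 + ‖ξ‖ ^ 4 / l ^ 4)⁻¹ := by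
    rw [freqWeight, norm_smul, Real.norm_of_nonneg (by positivity)]
    congr 1
    field_simp
  have hu : 0 < s * freqWeight (l⁻¹ • ξ) := by rw [hw]; positivity
  refine (le_add_sq_div hu).trans (add_le_add_right ?_ _)
  calc y ^ 2 / (s * freqWeight (l⁻¹ • ξ))
      = (‖ξ‖ ^ 2 * y ^ 2 / l ^ 2 + ‖ξ‖ ^ 4 * y ^ 2 / l ^ 4) / s := by
        rw [hw, div_mul_eq_div_div, div_inv_eq_mul]; ring
    _ ≤ _ := by gcongr

/-- Weighted pointwise bound for the Fourier transform in terms of the Fourier transforms of the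
first and pure second derivatives. -/
lemma norm_fourier_le (g : 𝓢(Sp, ℂ)) {l s : ℝ} (hl : 0 < l) (hs : 0 < s) {ξ : Sp} (hξ : ξ ≠ 0) :
    ‖𝓕 g ξ‖ ≤ s * freqWeight (l⁻¹ • ξ) +
      ((∑ i, ‖𝓕 (∂_{(EuclideanSpace.single i 1 : Sp)} g) ξ‖ ^ 2) / l ^ 2 +
        3 * (∑ i, ‖𝓕 (∂_{(EuclideanSpace.single i 1 : Sp)}
          (∂_{(EuclideanSpace.single i 1 : Sp)} g)) ξ‖ ^ 2) / l ^ 4) / s := by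
  exact le_weight_add hl hs hξ (norm_sq_mul_norm_fourier_sq_le g ξ)
    (norm_pow_four_mul_norm_fourier_sq_le g ξ)

/-- Pointwise bound with a frequency scale `l` and an amplitude `s` left free. -/
lemma norm_le_of_scales (f : 𝓢(Sp, ℝ)) {l s : ℝ} (hl : 0 < l) (hs : 0 < s) (x : Sp) :
    ‖f x‖ ≤ s * (l ^ 3 * ∫ η, freqWeight η) +
      ((∑ i, ∫ x, ‖(∂_{(EuclideanSpace.single i 1 : Sp)} f) x‖ ^ 2) / l ^ 2 +
        3 * (∑ i, ∫ x, ‖(∂_{(EuclideanSpace.single i 1 : Sp)}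
          (∂_{(EuclideanSpace.single i 1 : Sp)} f)) x‖ ^ 2) / l ^ 4) / s := by
  set g := complexify f with hg
  have hx : ‖f x‖ = ‖g x‖ := by simp [hg, complexify_apply]
  have hw : Integrable fun ξ : Sp => s * freqWeight (l⁻¹ • ξ) :=
    (integrable_freqWeight.comp_smul (inv_ne_zero hl.ne')).const_mul s
  have hA : Integrable fun ξ : Sp =>
      ∑ i, ‖𝓕 (∂_{(EuclideanSpace.single i 1 : Sp)} g) ξ‖ ^ 2 :=
    integrable_finsetSum _ fun i _ => integrable_norm_sq _
  have hB : Integrable fun ξ : Sp => ∑ i, ‖𝓕 (∂_{(EuclideanSpace.single i 1 : Sp)}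
      (∂_{(EuclideanSpace.single i 1 : Sp)} g)) ξ‖ ^ 2 :=
    integrable_finsetSum _ fun i _ => integrable_norm_sq _
  have hA' := hA.div_const (l ^ 2)
  have hB' := (hB.const_mul 3).div_const (l ^ 4)
  have hAB : Integrable fun ξ : Sp =>
      ((∑ i, ‖𝓕 (∂_{(EuclideanSpace.single i 1 : Sp)} g) ξ‖ ^ 2) / l ^ 2 +
        3 * (∑ i, ‖𝓕 (∂_{(EuclideanSpace.single i 1 : Sp)}
          (∂_{(EuclideanSpace.single i 1 : Sp)} g)) ξ‖ ^ 2) / l ^ 4) / s :=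
    (hA'.add hB').div_const s
  rw [hx]
  refine (norm_le_integral_norm_fourier g x).trans ?_
  have hmono := integral_mono_ae (𝓕 g).integrable.norm (hw.add hAB) (by
    filter_upwards [Measure.ae_ne volume (0 : Sp)] with ξ hξ
    exact norm_fourier_le g hl hs hξ)
  refine hmono.trans_eq ?_
  simp only [Pi.add_apply]
  rw [integral_add hw hAB, integral_const_mul, integral_freqWeight_comp_smul hl,
    integral_div, integral_add hA' hB', integral_div, integral_div, integral_const_mul,
    integral_finsetSum _ fun i _ => integrable_norm_sq _,
    integral_finsetSum _ fun i _ => integrable_norm_sq _]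
  simp only [hg, lineDeriv_complexify, integral_norm_sq_fourier_complexify]

/-- Optimizing over the scales. -/
lemma le_mul_rpow_of_scales {M K A B : ℝ} (hA : 0 ≤ A) (hB : 0 ≤ B)
    (h : ∀ l s : ℝ, 0 < l → 0 < s → M ≤ s * (l ^ 3 * K) + (A / l ^ 2 + 3 * B / l ^ 4) / s) :
    M ≤ (K + 4) * A ^ (1 / 4 : ℝ) * B ^ (1 / 4 : ℝ) := by
  have hpos : ∀ a b : ℝ, 0 < a → 0 < b → A ≤ a ^ 4 → B ≤ b ^ 4 → M ≤ (K + 4) * a * b := by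
    intro a b ha hb hAa hBb
    refine (h (b ^ 2 / a ^ 2) (a ^ 7 / b ^ 5) (by positivity) (by positivity)).trans ?_
    calc _ ≤ a ^ 7 / b ^ 5 * ((b ^ 2 / a ^ 2) ^ 3 * K) +
          (a ^ 4 / (b ^ 2 / a ^ 2) ^ 2 + 3 * b ^ 4 / (b ^ 2 / a ^ 2) ^ 4) / (a ^ 7 / b ^ 5) := by
          gcongr
      _ = (K + 4) * a * b := by field_simp; ring
  have hroot : ∀ {X : ℝ}, 0 ≤ X → ∀ e > 0, X ≤ (X ^ (1 / 4 : ℝ) + e) ^ 4 := by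
    intro X hX e he
    calc X = (X ^ (1 / 4 : ℝ)) ^ 4 := by
          rw [← Real.rpow_natCast, ← Real.rpow_mul hX]; norm_num
      _ ≤ _ := by gcongr; linarith
  have hlim : Filter.Tendsto
      (fun e : ℝ => (K + 4) * (A ^ (1 / 4 : ℝ) + e) * (B ^ (1 / 4 : ℝ) + e))
      (nhdsWithin 0 (Set.Ioi 0)) (nhds ((K + 4) * A ^ (1 / 4 : ℝ) * B ^ (1 / 4 : ℝ))) := by
    have hc : Continuous
        fun e : ℝ => (K + 4) * (A ^ (1 / 4 : ℝ) + e) * (B ^ (1 / 4 : ℝ) + e) := by fun_prop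
    simpa using (hc.tendsto 0).mono_left nhdsWithin_le_nhds
  refine ge_of_tendsto hlim ?_
  filter_upwards [self_mem_nhdsWithin] with e he
  have he' : 0 < e := he
  exact hpos _ _ (by positivity) (by positivity) (hroot hA e he) (hroot hB e he)

/-- **Gagliardo–Nirenberg type inequality** (Lemma 2.1, first inequality):
`‖f‖_{L^∞(ℝ³)} ≤ C ‖∇f‖_{L²}^{1/2} ‖∇²f‖_{L²}^{1/2}`. Here `(Σ_{|α|=1} ‖∂^α f‖²)^{1/4}`
is `‖∇f‖_{L²}^{1/2}` and `(Σ_{|α|=2} ‖∂^α f‖²)^{1/4}` is `‖∇²f‖_{L²}^{1/2}`. -/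
theorem Linfty_interpolation :
    ∃ C : ℝ, 0 < C ∧ ∀ f : SchwartzMap Sp ℝ,
      eLpNorm (⇑f) ⊤ volume ≤
        ENNReal.ofReal C * (dmSq 1 ⇑f) ^ (1/4 : ℝ) * (dmSq 2 ⇑f) ^ (1/4 : ℝ) := by
  have hK : 0 ≤ ∫ η, freqWeight η :=
    integral_nonneg fun η => by simp only [freqWeight, Pi.zero_apply]; positivity
  refine ⟨(∫ η, freqWeight η) + 4, by positivity, fun f => ?_⟩
  rw [eLpNorm_exponent_top]
  have hA : 0 ≤ ∑ i, ∫ x, ‖(∂_{(EuclideanSpace.single i 1 : Sp)} f) x‖ ^ 2 :=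
    Finset.sum_nonneg fun i _ => integral_nonneg fun x => by positivity
  have hB : 0 ≤ ∑ i, ∫ x, ‖(∂_{(EuclideanSpace.single i 1 : Sp)}
      (∂_{(EuclideanSpace.single i 1 : Sp)} f)) x‖ ^ 2 :=
    Finset.sum_nonneg fun i _ => integral_nonneg fun x => by positivity
  refine (eLpNormEssSup_le_of_ae_bound (Filter.Eventually.of_forall fun x =>
    le_mul_rpow_of_scales hA hB fun l s hl hs => norm_le_of_scales f hl hs x)).trans ?_
  rw [ENNReal.ofReal_mul (by positivity), ENNReal.ofReal_mul (by positivity),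
    ← ENNReal.ofReal_rpow_of_nonneg hA (by norm_num),
    ← ENNReal.ofReal_rpow_of_nonneg hB (by norm_num)]
  gcongr
  · exact sum_integral_pd_le_dmSq_one f
  · exact sum_integral_pd_pd_le_dmSq_two f
end
end

section
/- There exists a constant C > 0 such that for all Schwartz functions f, g : ℝ³ → ℝ one has ‖fg‖_{H³(ℝ³)} ≤ C ‖f‖_{H³(ℝ³)} ‖∇g‖_{H³(ℝ³)}, where for an integer m ≥ 0, ‖h‖_{H^m}² = Σ_{|α|≤m} ‖∂^α h‖²_{L²(ℝ³)} and ‖∇g‖_{H³}² = Σ_{|α|=1} ‖∂^α g‖²_{H³}. -/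
noncomputable section

open MeasureTheory
open scoped ENNReal

open SchwartzMap LineDeriv FourierTransform

/-- The weight `(‖ξ‖ + ‖ξ‖²)⁻¹` is square integrable on `ℝ³`. -/
lemma memLp_two_inv_norm_add_norm_sq :
    MemLp (fun ξ : Sp => (‖ξ‖ + ‖ξ‖ ^ 2)⁻¹) 2 volume := by
  rw [memLp_two_iff_integrable_sq (by fun_prop)]
  rw [integrable_fun_norm_addHaar volume (f := fun r : ℝ => ((r + r ^ 2)⁻¹) ^ 2)]
  refine (integrable_inv_one_add_sq.integrableOn (s := Set.Ioi 0)).mono' (by fun_prop) ?_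
  filter_upwards [ae_restrict_mem measurableSet_Ioi] with r hr
  have hr : 0 < r := hr
  have : r ^ (3 - 1) * ((r + r ^ 2)⁻¹) ^ 2 = ((1 + r) ^ 2)⁻¹ := by
    have : 1 + r ≠ 0 := by positivity
    field_simp
  simp only [finrank_euclideanSpace, Fintype.card_fin, smul_eq_mul, this]
  rw [Real.norm_of_nonneg (by positivity)]
  gcongr
  nlinarith

lemma norm_le_sum_norm_coord (ξ : Sp) : ‖ξ‖ ≤ ∑ i, |ξ i| := by
  rw [EuclideanSpace.norm_eq, Real.sqrt_le_left (by positivity)]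
  simpa using Finset.sum_sq_le_sq_sum_of_nonneg (s := Finset.univ) (f := fun i => |ξ i|)
    (fun i _ => abs_nonneg _)

/-- The partial derivative of a Schwartz function in the `i`-th coordinate direction. -/
abbrev schwartzPd {F : Type*} [NormedAddCommGroup F] [NormedSpace ℝ F] (i : Fin 3)
    (f : SchwartzMap Sp F) : SchwartzMap Sp F :=
  ∂_{(EuclideanSpace.single i 1 : Sp)} f

lemma norm_coord_mul_norm_fourier_le (h : SchwartzMap Sp ℂ) (i : Fin 3) (ξ : Sp) :
    |ξ i| * ‖𝓕 h ξ‖ ≤ ‖𝓕 (schwartzPd i h) ξ‖ := by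
  have ht : (fun x : Sp => inner ℝ x (EuclideanSpace.single i (1 : ℝ))).HasTemperateGrowth := by
    fun_prop
  have : ‖𝓕 (schwartzPd i h) ξ‖ = (2 * Real.pi) * (|ξ i| * ‖𝓕 h ξ‖) := by
    rw [fourier_lineDerivOp_eq, smul_apply, smulLeftCLM_apply_apply ht]
    simp [abs_of_pos Real.pi_pos, EuclideanSpace.inner_single_right]
  rw [this]
  have : 0 ≤ |ξ i| * ‖𝓕 h ξ‖ := by positivity
  nlinarith [Real.pi_gt_three]

lemma norm_mul_norm_fourier_le (h : SchwartzMap Sp ℂ) (ξ : Sp) :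
    ‖ξ‖ * ‖𝓕 h ξ‖ ≤ ∑ i, ‖𝓕 (schwartzPd i h) ξ‖ := by
  grw [norm_le_sum_norm_coord, Finset.sum_mul]
  exact Finset.sum_le_sum fun i _ => norm_coord_mul_norm_fourier_le h i ξ

lemma eLpNorm_two_fourier (h : SchwartzMap Sp ℂ) :
    eLpNorm (𝓕 h : SchwartzMap Sp ℂ) 2 volume = eLpNorm h 2 volume := by
  have h₁ := (𝓕 h : SchwartzMap Sp ℂ).eLpNorm_lt_top 2 volume
  have h₂ := h.eLpNorm_lt_top 2 volume
  have h₃ := norm_fourier_toL2_eq h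
  rw [norm_toLp, norm_toLp] at h₃
  rw [← ENNReal.ofReal_toReal h₁.ne, ← ENNReal.ofReal_toReal h₂.ne, h₃]

lemma enorm_le_eLpNorm_one_fourier (h : SchwartzMap Sp ℂ) (x : Sp) :
    ‖h x‖ₑ ≤ eLpNorm (𝓕 h : SchwartzMap Sp ℂ) 1 volume := by
  have hx : h x = ∫ v, Real.fourierChar (inner ℝ v x) • 𝓕 h v := by
    rw [← Real.fourierInv_eq, ← fourierInv_coe, fourierInv_fourier_eq]
  rw [hx, eLpNorm_one_eq_lintegral_enorm]
  refine (enorm_integral_le_lintegral_enorm _).trans_eq ?_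
  simp [← ofReal_norm]

/-- A Sobolev inequality: the supremum of a Schwartz function on `ℝ³` is controlled by the
`L²` norms of its first and second order derivatives. -/
lemma exists_enorm_le_of_eLpNorm_complex :
    ∃ K : ℝ≥0∞, K ≠ ∞ ∧ ∀ (h : SchwartzMap Sp ℂ) (M : ℝ≥0∞),
      (∀ i, eLpNorm (schwartzPd i h) 2 volume ≤ M) →
      (∀ i j, eLpNorm (schwartzPd i (schwartzPd j h)) 2 volume ≤ M) → ∀ x, ‖h x‖ₑ ≤ K * M := by
  refine ⟨eLpNorm (fun ξ : Sp => (‖ξ‖ + ‖ξ‖ ^ 2)⁻¹) 2 volume * 12,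
    ENNReal.mul_ne_top memLp_two_inv_norm_add_norm_sq.2.ne (by simp), fun h M h₁ h₂ x => ?_⟩
  let S : Sp → ℝ := (∑ i, fun ξ => ‖𝓕 (schwartzPd i h) ξ‖) +
    ∑ i, ∑ j, fun ξ => ‖𝓕 (schwartzPd j (schwartzPd i h)) ξ‖
  have hcont (u : SchwartzMap Sp ℂ) : AEStronglyMeasurable (fun ξ => ‖u ξ‖) volume :=
    u.continuous.norm.aestronglyMeasurable
  have hS : AEStronglyMeasurable S volume :=
    (Finset.aestronglyMeasurable_sum _ fun i _ => hcont _).add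
      (Finset.aestronglyMeasurable_sum _ fun i _ => Finset.aestronglyMeasurable_sum _
        fun j _ => hcont _)
  have hS_le : eLpNorm S 2 volume ≤ 12 * M := by
    calc eLpNorm S 2 volume
        ≤ (∑ _i : Fin 3, M) + ∑ _i : Fin 3, ∑ _j : Fin 3, M := by
          refine (eLpNorm_add_le (Finset.aestronglyMeasurable_sum _ fun i _ => hcont _)
            (Finset.aestronglyMeasurable_sum _ fun i _ => Finset.aestronglyMeasurable_sum _
              fun j _ => hcont _) (by norm_num)).trans (add_le_add ?_ ?_)
          · refine (eLpNorm_sum_le (fun i _ => hcont _) (by norm_num)).trans ?_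
            refine Finset.sum_le_sum fun i _ => ?_
            rw [eLpNorm_norm, eLpNorm_two_fourier]
            exact h₁ i
          · refine (eLpNorm_sum_le (fun i _ => Finset.aestronglyMeasurable_sum _
              fun j _ => hcont _) (by norm_num)).trans ?_
            refine Finset.sum_le_sum fun i _ => ?_
            refine (eLpNorm_sum_le (fun i _ => hcont _) (by norm_num)).trans ?_
            refine Finset.sum_le_sum fun j _ => ?_
            rw [eLpNorm_norm, eLpNorm_two_fourier]
            exact h₂ j i
      _ = 12 * M := by
          simp only [Finset.sum_const, Finset.card_univ, Fintype.card_fin, nsmul_eq_mul]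
          ring
  have hpt (ξ : Sp) : (‖ξ‖ + ‖ξ‖ ^ 2) * ‖𝓕 h ξ‖ ≤ S ξ := by
    have h3 := norm_mul_norm_fourier_le h ξ
    have h4 : ‖ξ‖ * (‖ξ‖ * ‖𝓕 h ξ‖) ≤
        ∑ i, ∑ j, ‖𝓕 (schwartzPd j (schwartzPd i h)) ξ‖ := by
      grw [h3, Finset.mul_sum]
      exact Finset.sum_le_sum fun i _ => norm_mul_norm_fourier_le _ ξ
    simp only [S, Pi.add_apply, Finset.sum_apply]
    linarith
  calc ‖h x‖ₑ ≤ eLpNorm (𝓕 h : SchwartzMap Sp ℂ) 1 volume := enorm_le_eLpNorm_one_fourier h x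
    _ ≤ eLpNorm ((fun ξ : Sp => (‖ξ‖ + ‖ξ‖ ^ 2)⁻¹) • S) 1 volume := by
        refine eLpNorm_mono_ae_real ?_
        filter_upwards [compl_mem_ae_iff.2 (measure_singleton (0 : Sp))] with ξ hξ
        have : 0 < ‖ξ‖ := norm_pos_iff.2 hξ
        rw [Pi.smul_apply', smul_eq_mul, ← div_eq_inv_mul, le_div_iff₀ (by positivity), mul_comm]
        exact hpt ξ
    _ ≤ eLpNorm (fun ξ : Sp => (‖ξ‖ + ‖ξ‖ ^ 2)⁻¹) 2 volume * eLpNorm S 2 volume :=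
        eLpNorm_smul_le_mul_eLpNorm hS (by fun_prop)
    _ ≤ _ := by grw [hS_le, mul_assoc]

/-- The complexification of a real-valued Schwartz function. -/
def schwartzOfReal (f : SchwartzMap Sp ℝ) : SchwartzMap Sp ℂ :=
  f.postcompCLM Complex.ofRealCLM

lemma schwartzPd_schwartzOfReal (i : Fin 3) (f : SchwartzMap Sp ℝ) :
    schwartzPd i (schwartzOfReal f) = schwartzOfReal (schwartzPd i f) := by
  ext x
  change fderiv ℝ (Complex.ofRealCLM ∘ f) x _ = Complex.ofRealCLM (fderiv ℝ f x _)
  rw [fderiv_comp _ (by fun_prop) f.differentiableAt]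
  simp

lemma eLpNorm_schwartzOfReal (f : SchwartzMap Sp ℝ) :
    eLpNorm (schwartzOfReal f) 2 volume = eLpNorm f 2 volume :=
  eLpNorm_congr_norm_ae (.of_forall fun x => Complex.norm_real (f x))

lemma exists_enorm_le_of_eLpNorm :
    ∃ K : ℝ≥0∞, K ≠ ∞ ∧ ∀ (h : SchwartzMap Sp ℝ) (M : ℝ≥0∞),
      (∀ i, eLpNorm (schwartzPd i h) 2 volume ≤ M) →
      (∀ i j, eLpNorm (schwartzPd i (schwartzPd j h)) 2 volume ≤ M) → ∀ x, ‖h x‖ₑ ≤ K * M := by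
  obtain ⟨K, hK, H⟩ := exists_enorm_le_of_eLpNorm_complex
  refine ⟨K, hK, fun h M h₁ h₂ x => ?_⟩
  have := H (schwartzOfReal h) M
    (by simpa only [schwartzPd_schwartzOfReal, eLpNorm_schwartzOfReal] using h₁)
    (by simpa only [schwartzPd_schwartzOfReal, eLpNorm_schwartzOfReal] using h₂) x
  rwa [← ofReal_norm, ← Complex.norm_real, ofReal_norm]

lemma schwartzPd_comm (i j : Fin 3) (f : SchwartzMap Sp ℝ) :
    schwartzPd i (schwartzPd j f) = schwartzPd j (schwartzPd i f) := by
  have key (v w x : Sp) : fderiv ℝ (fun y => fderiv ℝ f y w) x v = fderiv ℝ (fderiv ℝ f) x v w := by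
    have hd : DifferentiableAt ℝ (fderiv ℝ f) x := (fderivCLM ℝ Sp ℝ f).differentiableAt
    rw [fderiv_clm_apply hd (by fun_prop)]
    simp
  ext x
  change fderiv ℝ (fun y => fderiv ℝ f y _) x _ = fderiv ℝ (fun y => fderiv ℝ f y _) x _
  rw [key, key]
  exact ((f.contDiffAt 2).isSymmSndFDerivAt (by simp)).eq _ _

/-- Iterated partial derivative along a list of coordinate directions; the head of the list is the
outermost derivative. -/
def listPd (l : List (Fin 3)) (f : SchwartzMap Sp ℝ) : SchwartzMap Sp ℝ :=
  l.foldr schwartzPd f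

lemma listPd_nil (f : SchwartzMap Sp ℝ) : listPd [] f = f :=
  rfl

lemma listPd_append (l l' : List (Fin 3)) (f : SchwartzMap Sp ℝ) :
    listPd (l ++ l') f = listPd l (listPd l' f) :=
  List.foldr_append

lemma listPd_perm {l l' : List (Fin 3)} (h : l.Perm l') (f : SchwartzMap Sp ℝ) :
    listPd l f = listPd l' f :=
  haveI : LeftCommutative (schwartzPd : Fin 3 → SchwartzMap Sp ℝ → SchwartzMap Sp ℝ) :=
    ⟨schwartzPd_comm⟩
  h.foldr_eq f

lemma listPd_add (l : List (Fin 3)) (f g : SchwartzMap Sp ℝ) :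
    listPd l (f + g) = listPd l f + listPd l g := by
  induction l with
  | nil => rfl
  | cons i l ih =>
    change schwartzPd i (listPd l (f + g)) = _
    rw [ih]
    exact lineDerivOp_add _ _ _

lemma coe_listPd_replicate (n : ℕ) (i : Fin 3) (f : SchwartzMap Sp ℝ) :
    ⇑(listPd (List.replicate n i) f) = (pd i)^[n] f := by
  induction n with
  | zero => rfl
  | succ n ih =>
    rw [Function.iterate_succ_apply', ← ih]
    rfl

/-- The list of directions encoding the multi-index `(a, b, c)`. -/
def multiIndexList (a b c : ℕ) : List (Fin 3) :=
  List.replicate a 0 ++ (List.replicate b 1 ++ List.replicate c 2)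

lemma coe_listPd_multiIndexList (a b c : ℕ) (f : SchwartzMap Sp ℝ) :
    ⇑(listPd (multiIndexList a b c) f) = mpd a b c f := by
  simp only [multiIndexList, listPd_append, coe_listPd_replicate, mpd]

lemma perm_multiIndexList (l : List (Fin 3)) :
    l.Perm (multiIndexList (l.count 0) (l.count 1) (l.count 2)) := by
  rw [List.perm_iff_count]
  intro i
  fin_cases i <;> simp [multiIndexList, List.count_replicate]

lemma eLpNorm_listPd_le_sobSq {m : ℕ} {l : List (Fin 3)} (hl : l.length ≤ m)
    (f : SchwartzMap Sp ℝ) :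
    eLpNorm (listPd l f) 2 volume ≤ sobSq m f ^ (1 / 2 : ℝ) := by
  have hlen : l.count 0 + l.count 1 + l.count 2 ≤ m := by
    have := (perm_multiIndexList l).length_eq
    simp only [multiIndexList, List.length_append, List.length_replicate] at this
    omega
  have hle : nsq (listPd l f) ≤ sobSq m f := by
    rw [listPd_perm (perm_multiIndexList l), coe_listPd_multiIndexList]
    generalize l.count 0 = a at *
    generalize l.count 1 = b at *
    generalize l.count 2 = c at *
    unfold sobSq
    refine le_trans ?_ (Finset.single_le_sum (fun _ _ => zero_le)
      (Finset.mem_range.2 (by omega : a < m + 1)))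
    refine le_trans ?_ (Finset.single_le_sum (fun _ _ => zero_le)
      (Finset.mem_range.2 (by omega : b < m + 1)))
    refine le_trans ?_ (Finset.single_le_sum (fun _ _ => zero_le)
      (Finset.mem_range.2 (by omega : c < m + 1)))
    rw [if_pos hlen]
  rw [one_div, ENNReal.le_rpow_inv_iff (by norm_num)]
  simpa [nsq] using hle

lemma eLpNorm_listPd_le_gradSobSq {m : ℕ} {l : List (Fin 3)} (hl₀ : l ≠ [])
    (hl : l.length ≤ m + 1) (g : SchwartzMap Sp ℝ) :
    eLpNorm (listPd l g) 2 volume ≤ gradSobSq m g ^ (1 / 2 : ℝ) := by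
  obtain ⟨l, i, rfl⟩ := List.eq_nil_or_concat' l |>.resolve_left hl₀
  rw [listPd_append]
  refine (eLpNorm_listPd_le_sobSq (m := m) (by simpa using hl) (schwartzPd i g)).trans ?_
  gcongr
  exact Finset.single_le_sum (f := fun i => sobSq m (pd i g)) (fun _ _ => zero_le)
    (Finset.mem_univ i)

lemma sobSq_rpow_half_le {m : ℕ} {h : SchwartzMap Sp ℝ} {M : ℝ≥0∞}
    (hM : ∀ l : List (Fin 3), l.length ≤ m → eLpNorm (listPd l h) 2 volume ≤ M) :
    sobSq m h ^ (1 / 2 : ℝ) ≤ (m + 1) ^ 2 * M := by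
  have hterm (a b c : ℕ) : (if a + b + c ≤ m then nsq (mpd a b c h) else 0) ≤ M ^ 2 := by
    split_ifs with habc
    · rw [← coe_listPd_multiIndexList]
      unfold nsq
      gcongr
      exact hM _ (by simp [multiIndexList]; omega)
    · exact zero_le
  rw [one_div, ENNReal.rpow_inv_le_iff (by norm_num)]
  calc sobSq m h
      ≤ ∑ _a ∈ Finset.range (m + 1), ∑ _b ∈ Finset.range (m + 1), ∑ _c ∈ Finset.range (m + 1),
          M ^ 2 :=
        Finset.sum_le_sum fun a _ => Finset.sum_le_sum fun b _ => Finset.sum_le_sum fun c _ =>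
          hterm a b c
    _ = (m + 1) ^ 3 * M ^ 2 := by
        simp only [Finset.sum_const, Finset.card_range, nsmul_eq_mul]
        push_cast
        ring
    _ ≤ (m + 1) ^ 4 * M ^ 2 := by
        gcongr
        · exact le_add_self
        · norm_num
    _ = ((m + 1) ^ 2 * M) ^ (2 : ℝ) := by
        rw [ENNReal.rpow_two]
        ring

/-- The product of two real-valued Schwartz functions. -/
def schwartzMul (f g : SchwartzMap Sp ℝ) : SchwartzMap Sp ℝ :=
  pairing (ContinuousLinearMap.mul ℝ ℝ) f g

lemma schwartzPd_schwartzMul (i : Fin 3) (f g : SchwartzMap Sp ℝ) :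
    schwartzPd i (schwartzMul f g) =
      schwartzMul (schwartzPd i f) g + schwartzMul f (schwartzPd i g) := by
  ext x
  change fderiv ℝ (fun y => f y * g y) x _ = fderiv ℝ f x _ * g x + f x * fderiv ℝ g x _
  rw [fderiv_fun_mul f.differentiableAt g.differentiableAt]
  simp
  ring

lemma eLpNorm_schwartzMul_le_left {f g : SchwartzMap Sp ℝ} {A B : ℝ≥0∞}
    (hf : ∀ x, ‖f x‖ₑ ≤ A) (hg : eLpNorm g 2 volume ≤ B) :
    eLpNorm (schwartzMul f g) 2 volume ≤ A * B := by
  have hA : eLpNorm f ∞ volume ≤ A := by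
    rw [eLpNorm_exponent_top]
    exact eLpNormEssSup_le_of_ae_enorm_bound (.of_forall hf)
  grw [← hA, ← hg]
  exact eLpNorm_smul_le_eLpNorm_top_mul_eLpNorm 2 g.continuous.aestronglyMeasurable f

lemma schwartzMul_comm (f g : SchwartzMap Sp ℝ) : schwartzMul f g = schwartzMul g f := by
  ext x
  exact mul_comm _ _

/-- Leibniz bound: if all products of derivatives of `f` and `g` of total order at most `m` are
bounded by `M` in `L²`, so are, up to a factor, the derivatives of the product. -/
lemma eLpNorm_listPd_schwartzMul_le {f g : SchwartzMap Sp ℝ} {m : ℕ} {M : ℝ≥0∞}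
    (hM : ∀ p q : List (Fin 3), p.length + q.length ≤ m →
      eLpNorm (schwartzMul (listPd p f) (listPd q g)) 2 volume ≤ M)
    (l p q : List (Fin 3)) (hl : l.length + p.length + q.length ≤ m) :
    eLpNorm (listPd l (schwartzMul (listPd p f) (listPd q g))) 2 volume ≤ 2 ^ l.length * M := by
  induction l using List.reverseRecOn generalizing p q with
  | nil => simpa [listPd_nil] using hM p q (by simpa using hl)
  | append_singleton l i ih =>
    simp only [List.length_append, List.length_singleton] at hl
    have h₁ := ih (i :: p) q (by simp only [List.length_cons]; omega)
    have h₂ := ih p (i :: q) (by simp only [List.length_cons]; omega)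
    have : listPd (l ++ [i]) (schwartzMul (listPd p f) (listPd q g)) =
        listPd l (schwartzMul (listPd (i :: p) f) (listPd q g)) +
          listPd l (schwartzMul (listPd p f) (listPd (i :: q) g)) := by
      rw [listPd_append, ← listPd_add]
      exact congrArg _ (schwartzPd_schwartzMul i _ _)
    rw [this, FunLike.coe_add]
    grw [eLpNorm_add_le (SchwartzMap.continuous _).aestronglyMeasurable
      (SchwartzMap.continuous _).aestronglyMeasurable (by norm_num), h₁, h₂]
    simp only [List.length_append, List.length_singleton, pow_succ]
    exact le_of_eq (by ring)

/-- **Product estimate in `H³`** (Lemma 2.1, second inequality):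
`‖fg‖_{H³(ℝ³)} ≤ C ‖f‖_{H³} ‖∇g‖_{H³}`. -/
theorem product_H3_estimate :
    ∃ C : ℝ, 0 < C ∧ ∀ f g : SchwartzMap Sp ℝ,
      (sobSq 3 (fun x => f x * g x)) ^ (1/2 : ℝ) ≤
        ENNReal.ofReal C * (sobSq 3 ⇑f) ^ (1/2 : ℝ) * (gradSobSq 3 ⇑g) ^ (1/2 : ℝ) := by
  obtain ⟨K, hK, hsup⟩ := exists_enorm_le_of_eLpNorm
  refine ⟨128 * (K.toReal + 1), by positivity, fun f g => ?_⟩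
  set A := sobSq 3 f ^ (1 / 2 : ℝ) with hA
  set B := gradSobSq 3 g ^ (1 / 2 : ℝ) with hB
  have hprod (p q : List (Fin 3)) (hpq : p.length + q.length ≤ 3) :
      eLpNorm (schwartzMul (listPd p f) (listPd q g)) 2 volume ≤ K * (A * B) := by
    by_cases hq : q.length ≤ 2
    · rw [schwartzMul_comm]
      refine (eLpNorm_schwartzMul_le_left (A := K * B) (hsup _ B (fun i => ?_) fun i j => ?_)
        (eLpNorm_listPd_le_sobSq (m := 3) (by omega) f)).trans_eq (by rw [← hA]; ring)
      · exact eLpNorm_listPd_le_gradSobSq (l := i :: q) (by simp)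
          (by simp only [List.length_cons]; omega) g
      · exact eLpNorm_listPd_le_gradSobSq (l := i :: j :: q) (by simp)
          (by simp only [List.length_cons]; omega) g
    · obtain rfl : p = [] := List.length_eq_zero_iff.1 (by omega)
      refine (eLpNorm_schwartzMul_le_left (A := K * A) (hsup _ A (fun i => ?_) fun i j => ?_)
        (eLpNorm_listPd_le_gradSobSq (m := 3) (by rintro rfl; simp at hq)
          (by omega) g)).trans_eq (by rw [← hB]; ring)
      · exact eLpNorm_listPd_le_sobSq (l := [i]) (by simp) f
      · exact eLpNorm_listPd_le_sobSq (l := [i, j]) (by simp) f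
  have hder (l : List (Fin 3)) (hl : l.length ≤ 3) :
      eLpNorm (listPd l (schwartzMul f g)) 2 volume ≤ 8 * (K * (A * B)) := by
    refine (eLpNorm_listPd_schwartzMul_le hprod l [] [] (by simpa using hl)).trans ?_
    gcongr
    calc (2 : ℝ≥0∞) ^ l.length ≤ 2 ^ 3 := pow_le_pow_right₀ (by norm_num) hl
      _ = 8 := by norm_num
  refine (sobSq_rpow_half_le (h := schwartzMul f g) hder).trans ?_
  have hC : 128 * K ≤ ENNReal.ofReal (128 * (K.toReal + 1)) := by
    rw [ENNReal.ofReal_mul (by norm_num), ENNReal.ofReal_add (by simp) (by simp),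
      ENNReal.ofReal_toReal hK, ENNReal.ofReal_ofNat]
    gcongr
    exact le_self_add
  grw [← hC]
  refine le_of_eq ?_
  norm_num
  ring
end
end

section
/- Let 0 < l < 3 and 1 < q < p < ∞ with 1/p + l/3 = 1/q. Then there exists a constant C > 0, depending only on l, p, q, such that for every Schwartz function f : ℝ³ → ℝ, the function x ↦ ∫_{ℝ³} |x−y|^{l−3} f(y) dy satisfies ‖x ↦ ∫_{ℝ³} |x−y|^{l−3} f(y) dy‖_{L^p(ℝ³)} ≤ C ‖f‖_{L^q(ℝ³)}. -/
noncomputable section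

open MeasureTheory
open scoped ENNReal

lemma lintegral_indicator_norm_rpow (a : ℝ) {S : Set ℝ} (hS : MeasurableSet S)
    (hi : IntegrableOn (fun r : ℝ => r ^ (a + 2)) (Set.Ioi 0 ∩ S)) :
    ∫⁻ z : Sp, ENNReal.ofReal (S.indicator (fun r => r ^ a) ‖z‖) =
      ENNReal.ofReal (3 * volume.real (Metric.ball (0 : Sp) 1) *
        ∫ r in Set.Ioi 0 ∩ S, r ^ (a + 2)) := by
  have hmul : Set.EqOn (fun r : ℝ => r ^ (Module.finrank ℝ Sp - 1) • S.indicator (fun r => r ^ a) r)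
      (S.indicator fun r => r ^ (a + 2)) (Set.Ioi 0) := by
    intro r hr
    by_cases hrS : r ∈ S
    · have h2 : r ^ (a + 2) = r ^ a * r ^ 2 := by
        rw [Real.rpow_add hr, Real.rpow_two]
      simp [hrS, h2, mul_comm]
    · simp [hrS]
  have hint : Integrable (fun z : Sp => S.indicator (fun r => r ^ a) ‖z‖) := by
    rw [integrable_fun_norm_addHaar volume (f := S.indicator fun r => r ^ a),
      integrableOn_congr_fun hmul measurableSet_Ioi, IntegrableOn, integrable_indicator_iff hS,
      IntegrableOn, Measure.restrict_restrict hS, Set.inter_comm]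
    exact hi
  rw [← ofReal_integral_eq_lintegral_ofReal hint
    (Filter.Eventually.of_forall fun z =>
      Set.indicator_apply_nonneg fun _ => Real.rpow_nonneg (norm_nonneg z) a),
    integral_fun_norm_addHaar volume (S.indicator fun r => r ^ a),
    setIntegral_congr_fun measurableSet_Ioi hmul, setIntegral_indicator hS]
  simp [mul_assoc]

/-- Mass of `|z| ^ a` near the origin. -/
lemma lintegral_indicator_Iic_norm_rpow {a : ℝ} (ha : -3 < a) {R : ℝ} (hR : 0 < R) :
    ∫⁻ z : Sp, ENNReal.ofReal ((Set.Iic R).indicator (fun r => r ^ a) ‖z‖) =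
      ENNReal.ofReal (3 * volume.real (Metric.ball (0 : Sp) 1) / (a + 3) * R ^ (a + 3)) := by
  have hset : Set.Ioi 0 ∩ Set.Iic R = Set.Ioc 0 R := rfl
  rw [lintegral_indicator_norm_rpow a measurableSet_Iic, hset,
    ← intervalIntegral.integral_of_le hR.le, integral_rpow (Or.inl (by linarith)),
    show a + 2 + 1 = a + 3 by ring, Real.zero_rpow (by linarith)]
  · congr 1
    ring
  · rw [hset, ← intervalIntegrable_iff_integrableOn_Ioc_of_le hR.le]
    exact intervalIntegral.intervalIntegrable_rpow' (by linarith)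

/-- Mass of `|z| ^ a` away from the origin. -/
lemma lintegral_indicator_Ioi_norm_rpow {a : ℝ} (ha : a < -3) {R : ℝ} (hR : 0 < R) :
    ∫⁻ z : Sp, ENNReal.ofReal ((Set.Ioi R).indicator (fun r => r ^ a) ‖z‖) =
      ENNReal.ofReal (3 * volume.real (Metric.ball (0 : Sp) 1) / (-(a + 3)) * R ^ (a + 3)) := by
  have hset : Set.Ioi 0 ∩ Set.Ioi R = Set.Ioi R :=
    Set.inter_eq_right.2 (Set.Ioi_subset_Ioi hR.le)
  rw [lintegral_indicator_norm_rpow a measurableSet_Ioi, hset,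
    integral_Ioi_rpow_of_lt (by linarith) hR, show a + 2 + 1 = a + 3 by ring]
  · congr 1
    rw [div_neg, neg_div]
    ring
  · rw [hset]
    exact integrableOn_Ioi_rpow_of_lt (by linarith) hR

/-- The part of the kernel `|z| ^ a` where `|z| ∈ S`. -/
def truncatedKernel (a : ℝ) (S : Set ℝ) (z : Sp) : ℝ≥0∞ :=
  ENNReal.ofReal (S.indicator (fun r => r ^ a) ‖z‖)

lemma measurable_truncatedKernel (a : ℝ) {S : Set ℝ} (hS : MeasurableSet S) :
    Measurable (truncatedKernel a S) := by
  have h : Measurable (S.indicator fun r : ℝ => r ^ a) :=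
    (by fun_prop : Measurable fun r : ℝ => r ^ a).indicator hS
  exact (h.comp measurable_norm).ennreal_ofReal

lemma ofReal_norm_rpow_eq_add (a R : ℝ) (z : Sp) :
    ENNReal.ofReal (‖z‖ ^ a) =
      truncatedKernel a (Set.Iic R) z + truncatedKernel a (Set.Ioi R) z := by
  rcases le_or_gt ‖z‖ R with h | h
  · simp [truncatedKernel, h]
  · simp [truncatedKernel, h]

/-- Hölder bound of the far part of the potential. -/
lemma lintegral_truncatedKernel_Ioi_mul_le {a q q' : ℝ} (hq : q'.HolderConjugate q)
    (ha : a * q' < -3) {R : ℝ} (hR : 0 < R) {g : Sp → ℝ≥0∞} (hg : Measurable g)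
    (hg1 : ∫⁻ y, g y ^ q ≤ 1) (x : Sp) :
    ∫⁻ y, truncatedKernel a (Set.Ioi R) (x - y) * g y ≤
      ENNReal.ofReal ((3 * volume.real (Metric.ball (0 : Sp) 1) / (-(a * q' + 3))) ^ (1 / q') *
        R ^ (a + 3 / q')) := by
  have hq'0 : 0 < q' := hq.pos
  have hk := (measurable_truncatedKernel a (S := Set.Ioi R) measurableSet_Ioi).comp
    (measurable_const_sub x)
  have hpow : ∀ z : Sp, truncatedKernel a (Set.Ioi R) z ^ q' =
      ENNReal.ofReal ((Set.Ioi R).indicator (fun r => r ^ (a * q')) ‖z‖) := by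
    intro z
    have h0 : 0 ≤ (Set.Ioi R).indicator (fun r => r ^ a) ‖z‖ :=
      Set.indicator_apply_nonneg fun _ => Real.rpow_nonneg (norm_nonneg z) a
    rw [truncatedKernel, ENNReal.ofReal_rpow_of_nonneg h0 hq'0.le]
    by_cases h : ‖z‖ ∈ Set.Ioi R
    · simp only [Set.indicator_of_mem h, Real.rpow_mul (norm_nonneg z)]
    · simp only [Set.indicator_of_notMem h, Real.zero_rpow hq'0.ne']
  have hc : 0 ≤ 3 * volume.real (Metric.ball (0 : Sp) 1) / (-(a * q' + 3)) :=
    div_nonneg (by positivity) (by linarith)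
  have hexp : (a * q' + 3) * (1 / q') = a + 3 / q' := by
    field_simp
  calc ∫⁻ y, truncatedKernel a (Set.Ioi R) (x - y) * g y
      ≤ (∫⁻ y, truncatedKernel a (Set.Ioi R) (x - y) ^ q') ^ (1 / q') *
          (∫⁻ y, g y ^ q) ^ (1 / q) :=
        ENNReal.lintegral_mul_le_Lp_mul_Lq volume hq hk.aemeasurable hg.aemeasurable
    _ ≤ (∫⁻ y, truncatedKernel a (Set.Ioi R) (x - y) ^ q') ^ (1 / q') * 1 := by
        gcongr
        exact ENNReal.rpow_le_one hg1 (by simpa using hq.symm.nonneg)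
    _ = _ := by
        rw [mul_one, lintegral_sub_left_eq_self (fun z => truncatedKernel a (Set.Ioi R) z ^ q') x]
        simp_rw [hpow]
        rw [lintegral_indicator_Ioi_norm_rpow ha hR,
          ENNReal.ofReal_rpow_of_nonneg (by positivity) (by positivity),
          Real.mul_rpow hc (by positivity), ← Real.rpow_mul hR.le, hexp]

/-- The part of `h` above the level `s`. -/
def upperPart (h : Sp → ℝ) (s : ℝ) (x : Sp) : ℝ≥0∞ :=
  {x | s < h x}.indicator (fun x => ENNReal.ofReal (h x)) x

lemma measurable_upperPart {h : Sp → ℝ} (hh : Measurable h) :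
    Measurable fun z : ℝ × Sp => upperPart h z.1 z.2 := by
  have hset : MeasurableSet {z : ℝ × Sp | z.1 < h z.2} :=
    measurableSet_lt measurable_fst (hh.comp measurable_snd)
  exact ((hh.comp measurable_snd).ennreal_ofReal).indicator hset

lemma ofReal_le_upperPart_add (h : Sp → ℝ) (s : ℝ) (x : Sp) :
    ENNReal.ofReal (h x) ≤ upperPart h s x + ENNReal.ofReal s := by
  by_cases hx : s < h x
  · simp [upperPart, hx]
  · exact (ENNReal.ofReal_le_ofReal (not_lt.1 hx)).trans le_add_self

/-- Tonelli for the near part of the potential, and Chebyshev's inequality. -/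
lemma mul_measure_le_lintegral_upperPart {a : ℝ} (ha : -3 < a) {R : ℝ} (hR : 0 < R)
    {h : Sp → ℝ} (hh : Measurable h) (s : ℝ) (ε : ℝ≥0∞) :
    ε * volume {x : Sp | ε ≤ ∫⁻ y, truncatedKernel a (Set.Iic R) (x - y) * upperPart h s y} ≤
      ENNReal.ofReal (3 * volume.real (Metric.ball (0 : Sp) 1) / (a + 3) * R ^ (a + 3)) *
        ∫⁻ y, upperPart h s y := by
  have hk := measurable_truncatedKernel a (S := Set.Iic R) measurableSet_Iic
  have hu : Measurable (upperPart h s) :=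
    (measurable_upperPart hh).comp measurable_prodMk_left
  have hm : Measurable fun z : Sp × Sp =>
      truncatedKernel a (Set.Iic R) (z.1 - z.2) * upperPart h s z.2 :=
    (hk.comp measurable_sub).mul (hu.comp measurable_snd)
  refine (mul_meas_ge_le_lintegral hm.lintegral_prod_right' ε).trans ?_
  rw [lintegral_lintegral_swap hm.aemeasurable, ← lintegral_const_mul _ hu]
  refine (lintegral_congr fun y => ?_).le
  change ∫⁻ x, truncatedKernel a (Set.Iic R) (x - y) * upperPart h s y = _
  rw [lintegral_mul_const _ (by fun_prop),
    lintegral_sub_right_eq_self (truncatedKernel a (Set.Iic R)) y]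
  congr 1
  exact lintegral_indicator_Iic_norm_rpow ha hR

/-- Integrating the upper parts over all levels recovers the power `q`. -/
lemma lintegral_rpow_mul_upperPart {h : Sp → ℝ} (h0 : ∀ x, 0 ≤ h x)
    {p q : ℝ} (hq1 : 1 < q) (hp : 0 < p) (x : Sp) :
    ∫⁻ t in Set.Ioi (0 : ℝ), ENNReal.ofReal (t ^ (p - p / q - 1)) * upperPart h (t ^ (p / q)) x =
      ENNReal.ofReal (1 / (p - p / q)) * ENNReal.ofReal (h x ^ q) := by
  have hq : 0 < q := by linarith
  have hd : 0 < p - p / q := by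
    have := div_lt_self hp hq1
    linarith
  set b := h x ^ (q / p) with hb
  have hb0 : 0 ≤ b := Real.rpow_nonneg (h0 x) _
  have hfun : ∀ t ∈ Set.Ioi (0 : ℝ),
      ENNReal.ofReal (t ^ (p - p / q - 1)) * upperPart h (t ^ (p / q)) x =
      (Set.Iio b).indicator (fun t => ENNReal.ofReal (t ^ (p - p / q - 1))) t *
        ENNReal.ofReal (h x) := by
    intro t ht
    have hiff : t ^ (p / q) < h x ↔ t < b := by
      rw [hb, ← inv_div p q, Real.lt_rpow_inv_iff_of_pos (Set.mem_Ioi.1 ht).le (h0 x) (by positivity)]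
    by_cases htb : t < b
    · simp [upperPart, htb, hiff]
    · simp [upperPart, htb, hiff]
  have hmeas : Measurable fun t : ℝ => ENNReal.ofReal (t ^ (p - p / q - 1)) := by fun_prop
  have hexp : b ^ (p - p / q) * h x = h x ^ q := by
    rcases (h0 x).eq_or_lt with hx | hx
    · simp [← hx, Real.zero_rpow hq.ne']
    · rw [hb, ← Real.rpow_mul hx.le]
      nth_rewrite 2 [← Real.rpow_one (h x)]
      rw [← Real.rpow_add hx]
      congr 1
      field_simp
      ring
  rw [setLIntegral_congr_fun measurableSet_Ioi hfun,
    lintegral_mul_const _ (hmeas.indicator measurableSet_Iio),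
    setLIntegral_indicator measurableSet_Iio, Set.inter_comm, Set.Ioi_inter_Iio,
    setLIntegral_congr Ioo_ae_eq_Ioc, ← ofReal_integral_eq_lintegral_ofReal,
    ← intervalIntegral.integral_of_le hb0, integral_rpow (Or.inl (by linarith)),
    ← ENNReal.ofReal_mul' (h0 x), ← ENNReal.ofReal_mul (by positivity), ← hexp, sub_add_cancel,
    Real.zero_rpow hd.ne']
  · congr 1
    ring
  · exact (intervalIntegrable_iff_integrableOn_Ioc_of_le hb0).1
      (intervalIntegral.intervalIntegrable_rpow' (by linarith))
  · filter_upwards [ae_restrict_mem measurableSet_Ioc] with t ht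
    exact Real.rpow_nonneg ht.1.le _

/-- Weak-type bound for the potential of a function of unit `L^q` norm, keeping only the part of the
function above the level `t ^ (p / q)`. -/
lemma exists_measure_potential_le {l p q : ℝ} (hl0 : 0 < l) (hq1 : 1 < q) (hp : 0 < p)
    (hrel : 1 / p + l / 3 = 1 / q) :
    ∃ K A : ℝ, 0 < K ∧ 0 ≤ A ∧ ∀ h : Sp → ℝ, Measurable h →
      ∫⁻ y, ENNReal.ofReal (h y) ^ q ≤ 1 → ∀ t : ℝ, 0 < t →
      volume {x : Sp | ENNReal.ofReal (K * t) <
          ∫⁻ y, ENNReal.ofReal (‖x - y‖ ^ (l - 3)) * ENNReal.ofReal (h y)} ≤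
        ENNReal.ofReal (A * t ^ (-(p / q))) * ∫⁻ y, upperPart h (t ^ (p / q)) y := by
  have hq0 : 0 < q := by linarith
  obtain ⟨q', hconj⟩ : ∃ q' : ℝ, q'.HolderConjugate q :=
    ⟨_, (Real.HolderConjugate.conjExponent hq1).symm⟩
  have hq'0 : 0 < q' := hconj.pos
  have hinv : 1 / q' = 1 - 1 / q := by
    have := hconj.inv_add_inv_eq_one
    simp only [one_div]
    linarith
  have hfar : l - 3 + 3 / q' = -3 / p := by
    have h3 : 3 / q' = 3 * (1 / q') := by ring
    have hp3 : -3 / p = -3 * (1 / p) := by ring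
    rw [h3, hp3, hinv]
    linarith
  have ha : (l - 3) * q' < -3 := by
    have h1 : (l - 3) * q' + 3 = (l - 3 + 3 / q') * q' := by field_simp
    have h2 : (l - 3 + 3 / q') * q' < 0 := by
      rw [hfar]
      exact mul_neg_of_neg_of_pos (div_neg_of_neg_of_pos (by norm_num) hp) hq'0
    linarith
  set A : ℝ := 3 * volume.real (Metric.ball (0 : Sp) 1) / (l - 3 + 3) with hA
  set B : ℝ := (3 * volume.real (Metric.ball (0 : Sp) 1) / (-((l - 3) * q' + 3))) ^ (1 / q') with hB
  have hA0 : 0 ≤ A := div_nonneg (by positivity) (by linarith)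
  have hB0 : 0 ≤ B := Real.rpow_nonneg (div_nonneg (by positivity) (by linarith)) _
  refine ⟨A + 1 + B, A, by positivity, hA0, fun h hh hnorm t ht => ?_⟩
  have hR : 0 < t ^ (-(p / 3)) := Real.rpow_pos_of_pos ht _
  set R := t ^ (-(p / 3)) with hRdef
  set s := t ^ (p / q) with hs
  have hs0 : 0 ≤ s := by positivity
  have hpq : p / q = 1 + p * l / 3 := by
    rw [div_eq_mul_one_div p q, ← hrel]
    field_simp
  have hRfar : R ^ (l - 3 + 3 / q') = t := by
    rw [hfar, hRdef, ← Real.rpow_mul ht.le, show -(p / 3) * (-3 / p) = 1 by field_simp,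
      Real.rpow_one]
  have hRl : R ^ (l - 3 + 3) = t * t ^ (-(p / q)) := by
    rw [hRdef, ← Real.rpow_mul ht.le]
    nth_rewrite 2 [← Real.rpow_one t]
    rw [← Real.rpow_add ht, hpq]
    congr 1
    ring
  have hRs : R ^ (l - 3 + 3) * s = t := by
    rw [hRl, hs, mul_assoc, ← Real.rpow_add ht, neg_add_cancel, Real.rpow_zero, mul_one]
  have hkn := measurable_truncatedKernel (l - 3) (S := Set.Iic R) measurableSet_Iic
  have hkf := measurable_truncatedKernel (l - 3) (S := Set.Ioi R) measurableSet_Ioi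
  have hu : Measurable (upperPart h s) := (measurable_upperPart hh).comp measurable_prodMk_left
  have hsub : {x : Sp | ENNReal.ofReal ((A + 1 + B) * t) <
      ∫⁻ y, ENNReal.ofReal (‖x - y‖ ^ (l - 3)) * ENNReal.ofReal (h y)} ⊆
      {x : Sp | ENNReal.ofReal t ≤
        ∫⁻ y, truncatedKernel (l - 3) (Set.Iic R) (x - y) * upperPart h s y} := by
    intro x hx
    by_contra hcon
    simp only [Set.mem_ofPred_eq, not_le] at hx hcon
    refine absurd hx (not_lt.2 ?_)
    calc ∫⁻ y, ENNReal.ofReal (‖x - y‖ ^ (l - 3)) * ENNReal.ofReal (h y)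
        ≤ ∫⁻ y, (truncatedKernel (l - 3) (Set.Iic R) (x - y) * ENNReal.ofReal s +
            truncatedKernel (l - 3) (Set.Iic R) (x - y) * upperPart h s y) +
            truncatedKernel (l - 3) (Set.Ioi R) (x - y) * ENNReal.ofReal (h y) := by
          refine lintegral_mono fun y => ?_
          simp only
          rw [ofReal_norm_rpow_eq_add _ R, add_mul, ← mul_add, add_comm (ENNReal.ofReal s)]
          gcongr
          exact ofReal_le_upperPart_add h s y
      _ = ((∫⁻ y, truncatedKernel (l - 3) (Set.Iic R) (x - y)) * ENNReal.ofReal s +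
            ∫⁻ y, truncatedKernel (l - 3) (Set.Iic R) (x - y) * upperPart h s y) +
            ∫⁻ y, truncatedKernel (l - 3) (Set.Ioi R) (x - y) * ENNReal.ofReal (h y) := by
          rw [lintegral_add_left (by fun_prop), lintegral_add_left (by fun_prop),
            lintegral_mul_const _ (by fun_prop)]
      _ ≤ (ENNReal.ofReal (A * R ^ (l - 3 + 3)) * ENNReal.ofReal s + ENNReal.ofReal t) +
            ENNReal.ofReal (B * R ^ (l - 3 + 3 / q')) := by
          gcongr
          · rw [lintegral_sub_left_eq_self (truncatedKernel (l - 3) (Set.Iic R)) x]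
            exact (lintegral_indicator_Iic_norm_rpow (by linarith) hR).le
          · exact lintegral_truncatedKernel_Ioi_mul_le hconj ha hR hh.ennreal_ofReal hnorm x
      _ = ENNReal.ofReal ((A + 1 + B) * t) := by
          rw [hRfar, ← ENNReal.ofReal_mul' hs0, mul_assoc, hRs,
            ← ENNReal.ofReal_add (by positivity) ht.le,
            ← ENNReal.ofReal_add (by positivity) (by positivity)]
          congr 1
          ring
  refine (measure_mono hsub).trans ?_
  have hcheb := mul_measure_le_lintegral_upperPart (a := l - 3) (by linarith) hR hh s
    (ENNReal.ofReal t)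
  rw [← hA, hRl, mul_left_comm, ENNReal.ofReal_mul ht.le, mul_assoc] at hcheb
  exact (ENNReal.mul_le_mul_iff_right (by simpa using ht) ENNReal.ofReal_ne_top).1 hcheb

/-- The strong-type bound for functions of unit `L^q` norm. -/
lemma exists_lintegral_potential_rpow_le {l p q : ℝ} (hl0 : 0 < l) (hq1 : 1 < q) (hp : 0 < p)
    (hrel : 1 / p + l / 3 = 1 / q) :
    ∃ C : ℝ, 0 ≤ C ∧ ∀ f : Sp → ℝ, Measurable f → ∫⁻ y, ‖f y‖ₑ ^ q ≤ 1 →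
      ∫⁻ x, ‖∫ y : Sp, ‖x - y‖ ^ (l - 3) * f y‖ₑ ^ p ≤ ENNReal.ofReal C := by
  obtain ⟨K, A, hK, hA, hweak⟩ := exists_measure_potential_le hl0 hq1 hp hrel
  have hq0 : 0 < q := by linarith
  have hd : 0 < p - p / q := by
    have := div_lt_self hp hq1
    linarith
  refine ⟨K ^ p * (p * (A * (1 / (p - p / q)))), by positivity, fun f hf hnorm => ?_⟩
  set h : Sp → ℝ := fun y => ‖f y‖ with hh
  have hhm : Measurable h := hf.norm
  have hnorm' : ∫⁻ y, ENNReal.ofReal (h y) ^ q ≤ 1 := by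
    simpa only [hh, ofReal_norm] using hnorm
  set u : Sp → ℝ := fun x => ‖∫ y : Sp, ‖x - y‖ ^ (l - 3) * f y‖ / K with hu
  have hum : Measurable u := by
    have hj : StronglyMeasurable (Function.uncurry fun x y : Sp => ‖x - y‖ ^ (l - 3) * f y) := by
      refine Measurable.stronglyMeasurable ?_
      simp only [Function.uncurry_def]
      fun_prop
    exact hj.integral_prod_right.measurable.norm.div_const K
  have hscale : ∀ x, ‖∫ y : Sp, ‖x - y‖ ^ (l - 3) * f y‖ₑ ^ p =
      ENNReal.ofReal (K ^ p) * ENNReal.ofReal (u x ^ p) := by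
    intro x
    rw [← ENNReal.ofReal_mul (by positivity), ← Real.mul_rpow hK.le (by positivity), hu,
      mul_div_cancel₀ _ hK.ne', ← ENNReal.ofReal_rpow_of_nonneg (by positivity) hp.le, ofReal_norm]
  have hlevel : ∀ t ∈ Set.Ioi (0 : ℝ), volume {x | t < u x} * ENNReal.ofReal (t ^ (p - 1)) ≤
      ENNReal.ofReal A *
        ∫⁻ y, ENNReal.ofReal (t ^ (p - p / q - 1)) * upperPart h (t ^ (p / q)) y := by
    intro t ht
    have hsub : {x | t < u x} ⊆ {x : Sp | ENNReal.ofReal (K * t) <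
        ∫⁻ y, ENNReal.ofReal (‖x - y‖ ^ (l - 3)) * ENNReal.ofReal (h y)} := by
      intro x hx
      have hx' : K * t < ‖∫ y : Sp, ‖x - y‖ ^ (l - 3) * f y‖ := by
        rw [mul_comm]
        exact (lt_div_iff₀ hK).1 hx
      calc ENNReal.ofReal (K * t) < ENNReal.ofReal ‖∫ y : Sp, ‖x - y‖ ^ (l - 3) * f y‖ :=
            (ENNReal.ofReal_lt_ofReal_iff_of_nonneg (mul_pos hK ht).le).2 hx'
        _ = ‖∫ y : Sp, ‖x - y‖ ^ (l - 3) * f y‖ₑ := ofReal_norm _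
        _ ≤ ∫⁻ y : Sp, ‖‖x - y‖ ^ (l - 3) * f y‖ₑ := enorm_integral_le_lintegral_enorm _
        _ = _ := by
          refine lintegral_congr fun y => ?_
          rw [enorm_mul, Real.enorm_of_nonneg (by positivity), hh, ofReal_norm]
    have hum' : Measurable (upperPart h (t ^ (p / q))) :=
      (measurable_upperPart hhm).comp measurable_prodMk_left
    have hpow : t ^ (p - p / q - 1) = t ^ (-(p / q)) * t ^ (p - 1) := by
      rw [← Real.rpow_add ht]
      congr 1
      ring
    calc volume {x | t < u x} * ENNReal.ofReal (t ^ (p - 1))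
        ≤ (ENNReal.ofReal (A * t ^ (-(p / q))) * ∫⁻ y, upperPart h (t ^ (p / q)) y) *
            ENNReal.ofReal (t ^ (p - 1)) := by
          gcongr
          exact (measure_mono hsub).trans (hweak h hhm hnorm' t ht)
      _ = _ := by
          rw [lintegral_const_mul _ hum', hpow,
            ENNReal.ofReal_mul (Real.rpow_nonneg (Set.mem_Ioi.1 ht).le _), ENNReal.ofReal_mul hA]
          ring
  have hjoint : Measurable fun z : ℝ × Sp =>
      ENNReal.ofReal (z.1 ^ (p - p / q - 1)) * upperPart h (z.1 ^ (p / q)) z.2 := by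
    have h1 : Measurable fun z : ℝ × Sp => upperPart h (z.1 ^ (p / q)) z.2 :=
      (measurable_upperPart hhm).comp
        (by fun_prop : Measurable fun z : ℝ × Sp => (z.1 ^ (p / q), z.2))
    fun_prop
  simp_rw [hscale]
  rw [lintegral_const_mul _ (by fun_prop), lintegral_rpow_eq_lintegral_meas_lt_mul volume
    (Filter.Eventually.of_forall fun x => by positivity) hum.aemeasurable hp,
    ENNReal.ofReal_mul (by positivity), ENNReal.ofReal_mul hp.le]
  gcongr
  calc ∫⁻ t in Set.Ioi (0 : ℝ), volume {x | t < u x} * ENNReal.ofReal (t ^ (p - 1))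
      ≤ ∫⁻ t in Set.Ioi (0 : ℝ), ENNReal.ofReal A *
          ∫⁻ y, ENNReal.ofReal (t ^ (p - p / q - 1)) * upperPart h (t ^ (p / q)) y :=
        setLIntegral_mono' measurableSet_Ioi hlevel
    _ = ENNReal.ofReal A * ∫⁻ y, ∫⁻ t in Set.Ioi (0 : ℝ),
          ENNReal.ofReal (t ^ (p - p / q - 1)) * upperPart h (t ^ (p / q)) y := by
        rw [lintegral_const_mul _ hjoint.lintegral_prod_right',
          lintegral_lintegral_swap hjoint.aemeasurable]
    _ = ENNReal.ofReal A * (ENNReal.ofReal (1 / (p - p / q)) *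
          ∫⁻ y, ENNReal.ofReal (h y ^ q)) := by
        rw [← lintegral_const_mul (ENNReal.ofReal (1 / (p - p / q))) (by fun_prop)]
        congr 1
        exact lintegral_congr fun y =>
          lintegral_rpow_mul_upperPart (fun x => norm_nonneg (f x)) hq1 hp y
    _ ≤ ENNReal.ofReal A * (ENNReal.ofReal (1 / (p - p / q)) * 1) := by
        gcongr
        refine le_of_eq_of_le (lintegral_congr fun y => ?_) hnorm'
        rw [ENNReal.ofReal_rpow_of_nonneg (norm_nonneg _) hq0.le]
    _ = _ := by rw [mul_one, ENNReal.ofReal_mul hA]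

/-- **Hardy–Littlewood–Sobolev inequality for the Riesz potential** (Lemma 2.8):
for `0 < l < 3`, `1 < q < p < ∞` with `1/p + l/3 = 1/q`, the Riesz potential
`x ↦ ∫_{ℝ³} |x−y|^{l−3} f(y) dy` has `L^p` norm bounded by `C ‖f‖_{L^q}`. -/
theorem riesz_potential_estimate (l p q : ℝ) (hl0 : 0 < l) (hl3 : l < 3)
    (hq1 : 1 < q) (hqp : q < p) (hrel : 1 / p + l / 3 = 1 / q) :
    ∃ C : ℝ, 0 < C ∧ ∀ f : SchwartzMap Sp ℝ,
      eLpNorm (fun x : Sp => ∫ y : Sp, ‖x - y‖ ^ (l - 3) * f y) (ENNReal.ofReal p) volume ≤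
        ENNReal.ofReal C * eLpNorm (⇑f) (ENNReal.ofReal q) volume := by
  have hq0 : 0 < q := by linarith
  have hp0 : 0 < p := by linarith
  obtain ⟨C, hC, hbound⟩ := exists_lintegral_potential_rpow_le hl0 hq1 hp0 hrel
  refine ⟨C ^ (1 / p) + 1, by positivity, fun f => ?_⟩
  have hpe : ENNReal.ofReal p ≠ 0 := by simpa using hp0
  have hqe : ENNReal.ofReal q ≠ 0 := by simpa using hq0
  have hfm : Measurable f := f.continuous.measurable
  have hfin : eLpNorm f (ENNReal.ofReal q) volume ≠ ∞ :=
    (f.memLp (ENNReal.ofReal q) volume).eLpNorm_ne_top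
  obtain ⟨N, hN, hNeq⟩ : ∃ N : ℝ, 0 ≤ N ∧ eLpNorm f (ENNReal.ofReal q) volume = ENNReal.ofReal N :=
    ⟨_, ENNReal.toReal_nonneg, (ENNReal.ofReal_toReal hfin).symm⟩
  rcases hN.eq_or_lt with hN0 | hN0
  · have hf0 : f =ᵐ[volume] 0 := by
      rw [← eLpNorm_eq_zero_iff hfm.aestronglyMeasurable hqe, hNeq, ← hN0, ENNReal.ofReal_zero]
    have hzero : (fun x : Sp => ∫ y : Sp, ‖x - y‖ ^ (l - 3) * f y) = 0 := by
      funext x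
      refine integral_eq_zero_of_ae ?_
      filter_upwards [hf0] with y hy
      simp [hy]
    simp [hzero]
  · set f₁ : Sp → ℝ := N⁻¹ • ⇑f with hf₁
    have hf₁m : Measurable f₁ := hfm.const_smul _
    have hN1 : ‖N⁻¹‖ₑ * ENNReal.ofReal N = 1 := by
      rw [Real.enorm_of_nonneg (by positivity), ← ENNReal.ofReal_mul (by positivity),
        inv_mul_cancel₀ hN0.ne', ENNReal.ofReal_one]
    have hnorm₁ : ∫⁻ y, ‖f₁ y‖ₑ ^ q ≤ 1 := by
      have h1 : eLpNorm f₁ (ENNReal.ofReal q) volume ≤ 1 := by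
        rw [hf₁, eLpNorm_const_smul, hNeq, hN1]
      rw [eLpNorm_eq_lintegral_rpow_enorm_toReal hqe ENNReal.ofReal_ne_top,
        ENNReal.toReal_ofReal hq0.le, one_div, ENNReal.rpow_inv_le_iff hq0,
        ENNReal.one_rpow] at h1
      exact h1
    have hres : (fun x : Sp => ∫ y : Sp, ‖x - y‖ ^ (l - 3) * f y) =
        N • fun x : Sp => ∫ y : Sp, ‖x - y‖ ^ (l - 3) * f₁ y := by
      funext x
      rw [Pi.smul_apply, smul_eq_mul, ← integral_const_mul]
      congr 1
      funext y
      simp only [hf₁, Pi.smul_apply, smul_eq_mul]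
      field_simp
    rw [hres, eLpNorm_const_smul, hNeq, Real.enorm_of_nonneg hN0.le, mul_comm]
    gcongr
    rw [eLpNorm_eq_lintegral_rpow_enorm_toReal hpe ENNReal.ofReal_ne_top,
      ENNReal.toReal_ofReal hp0.le]
    calc (∫⁻ x, ‖∫ y : Sp, ‖x - y‖ ^ (l - 3) * f₁ y‖ₑ ^ p) ^ (1 / p)
        ≤ ENNReal.ofReal C ^ (1 / p) := by
          gcongr
          exact hbound f₁ hf₁m hnorm₁
      _ ≤ ENNReal.ofReal (C ^ (1 / p) + 1) := by
          rw [ENNReal.ofReal_rpow_of_nonneg hC (by positivity)]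
          exact ENNReal.ofReal_le_ofReal (by linarith)
end
end

section
/- Let 0 < r₀ ≤ R₀. Then there exist constants C > 0 and c₁ > 0 such that for every r with r₀ ≤ r ≤ R₀, every continuous F : [0,∞) → ℝ⁵, and every continuously differentiable V : [0,∞) → ℝ⁵ satisfying V′(t) = −A(r)·V(t) + F(t) for all t ≥ 0, one has for all t ≥ 0: ‖V(t)‖ ≤ C e^{−c₁ t} ‖V(0)‖ + C ∫₀ᵗ e^{−c₁(t−τ)} ‖F(τ)‖ dτ, where ‖·‖ is the Euclidean norm on ℝ⁵. -/
noncomputable section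

/-- The matrix `𝒜(ξ)` of the linearized NSF–P1 system at a frequency of
modulus `r = |ξ|`. -/
def Amat (r : ℝ) : Matrix (Fin 5) (Fin 5) ℝ :=
  !![0,  r,     0,     0,  0;
     -r, 3*r^2, -r,    0,  -1;
     0,  r,     r^2+4, -1, 0;
     0,  0,     -4,    1,  r;
     0,  0,     0,     -r, 1]

/-- `ℬ(ξ) = −𝒜(ξ)`. -/
def Bmat (r : ℝ) : Matrix (Fin 5) (Fin 5) ℝ := -Amat r

open Set Matrix MeasureTheory

/-- On a compact set, a nonnegative continuous function becomes positive after adding a small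
multiple of a continuous function that is positive on its zero set. -/
theorem IsCompact.exists_forall_add_mul_pos {X : Type*} [TopologicalSpace X] [T2Space X]
    {S : Set X} (hS : IsCompact S) {f g : X → ℝ} (hf : ContinuousOn f S) (hg : ContinuousOn g S)
    (hf0 : ∀ x ∈ S, 0 ≤ f x) (hfg : ∀ x ∈ S, f x = 0 → 0 < g x) :
    ∃ δ > 0, ∀ ε, 0 < ε → ε ≤ δ → ∀ x ∈ S, 0 < f x + ε * g x := by
  have hZ : IsCompact (S ∩ g ⁻¹' Iic 0) :=
    hS.of_isClosed_subset (hg.preimage_isClosed_of_isClosed hS.isClosed isClosed_Iic)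
      inter_subset_left
  obtain ⟨m, hm, hmf⟩ := hZ.exists_forall_le' (hf.mono inter_subset_left) (a := 0)
    fun x hx ↦ (hf0 x hx.1).lt_of_ne' fun h ↦ (hfg x hx.1 h).not_ge hx.2
  obtain ⟨B, hB⟩ := hS.exists_bound_of_continuousOn hg
  have hB1 : 0 < |B| + 1 := by positivity
  refine ⟨m / (|B| + 1), by positivity, fun ε hε hεδ x hx ↦ ?_⟩
  by_cases hgx : 0 < g x
  · have := hf0 x hx
    positivity
  · have h1 : ε * (|B| + 1) ≤ m := (le_div_iff₀ hB1).1 hεδ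
    have h2 := hmf x ⟨hx, not_lt.1 hgx⟩
    have h3 : -g x ≤ |B| := (neg_le_abs _).trans ((hB x hx).trans (le_abs_self B))
    nlinarith

section QuadraticForms

variable {ι : Type*} [Fintype ι]

theorem continuousOn_dotProduct_mulVec {K : Set ℝ} {P : ℝ → Matrix ι ι ℝ}
    (hP : ContinuousOn P K) (T : Set (ι → ℝ)) :
    ContinuousOn (fun x : ℝ × (ι → ℝ) ↦ x.2 ⬝ᵥ P x.1 *ᵥ x.2) (K ×ˢ T) := by
  have hP' : ContinuousOn (fun x : ℝ × (ι → ℝ) ↦ P x.1) (K ×ˢ T) :=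
    hP.comp continuousOn_fst fun x hx ↦ hx.1
  have hentry : ∀ i j, ContinuousOn (fun x : ℝ × (ι → ℝ) ↦ P x.1 i j) (K ×ˢ T) := fun i j ↦
    continuousOn_pi.1 (continuousOn_pi.1 hP' i) j
  have hcoord : ∀ i, ContinuousOn (fun x : ℝ × (ι → ℝ) ↦ x.2 i) (K ×ˢ T) := fun i ↦
    ((continuous_apply i).comp continuous_snd).continuousOn
  exact continuousOn_finsetSum _ fun i _ ↦ (hcoord i).mul <|
    continuousOn_finsetSum _ fun j _ ↦ (hentry i j).mul (hcoord j)

/-- A family of positive semidefinite quadratic forms over a compact parameter set becomes positive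
definite after adding a small multiple of a family that is positive on the kernels. -/
theorem exists_forall_dotProduct_add_smul_pos {K : Set ℝ} (hK : IsCompact K)
    {P Q : ℝ → Matrix ι ι ℝ} (hP : ContinuousOn P K) (hQ : ContinuousOn Q K)
    (hP0 : ∀ r ∈ K, ∀ v, 0 ≤ v ⬝ᵥ P r *ᵥ v)
    (hPQ : ∀ r ∈ K, ∀ v, v ≠ 0 → v ⬝ᵥ P r *ᵥ v = 0 → 0 < v ⬝ᵥ Q r *ᵥ v) :
    ∃ δ > 0, ∀ ε, 0 < ε → ε ≤ δ → ∀ r ∈ K, ∀ v, v ≠ 0 →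
      0 < v ⬝ᵥ P r *ᵥ v + ε * (v ⬝ᵥ Q r *ᵥ v) := by
  obtain ⟨δ, hδ, h⟩ := (hK.prod (isCompact_sphere (0 : ι → ℝ) 1)).exists_forall_add_mul_pos
    (continuousOn_dotProduct_mulVec hP _) (continuousOn_dotProduct_mulVec hQ _)
    (fun x hx ↦ hP0 x.1 hx.1 x.2)
    (fun x hx ↦ hPQ x.1 hx.1 x.2 (ne_zero_of_mem_unit_sphere ⟨x.2, hx.2⟩))
  refine ⟨δ, hδ, fun ε hε hεδ r hr v hv ↦ ?_⟩
  have hv' : 0 < ‖v‖ := norm_pos_iff.2 hv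
  have hu : ‖v‖⁻¹ • v ∈ Metric.sphere (0 : ι → ℝ) 1 := by
    simp [norm_smul, hv'.ne']
  have := h ε hε hεδ (r, ‖v‖⁻¹ • v) ⟨hr, hu⟩
  simp only [mulVec_smul, smul_dotProduct, dotProduct_smul, smul_eq_mul] at this
  have h2 : 0 < ‖v‖⁻¹ * ‖v‖⁻¹ * (v ⬝ᵥ P r *ᵥ v + ε * (v ⬝ᵥ Q r *ᵥ v)) := by linarith
  exact pos_of_mul_pos_right h2 (by positivity)

theorem sq_dotProduct_mulVec_le {P : Matrix ι ι ℝ} (hs : P.IsSymm)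
    (h0 : ∀ v, 0 ≤ v ⬝ᵥ P *ᵥ v) (v w : ι → ℝ) :
    (v ⬝ᵥ P *ᵥ w) ^ 2 ≤ (v ⬝ᵥ P *ᵥ v) * (w ⬝ᵥ P *ᵥ w) := by
  classical
  have hsymm : LinearMap.IsSymm (Matrix.toBilin' P) := ⟨fun x y ↦ by
    simp only [Matrix.toBilin'_apply', RingHom.id_apply]
    rw [dotProduct_mulVec, ← mulVec_transpose, hs.eq, dotProduct_comm]⟩
  simpa only [Matrix.toBilin'_apply'] using
    LinearMap.BilinForm.apply_sq_le_of_symm (Matrix.toBilin' P)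
      (fun x ↦ by simpa only [Matrix.toBilin'_apply'] using h0 x) hsymm v w

/-- The system `V′ = -A V` has a quadratic Lyapunov function lying between `m ‖v‖²` and `M ‖v‖²`
and decaying at least like `exp (-2 c t)`. -/
def HasLyapunovForm (A : Matrix ι ι ℝ) (m M c : ℝ) : Prop :=
  ∃ P : Matrix ι ι ℝ, P.IsSymm ∧ (∀ v, m * (v ⬝ᵥ v) ≤ v ⬝ᵥ P *ᵥ v) ∧
    (∀ v, v ⬝ᵥ P *ᵥ v ≤ M * (v ⬝ᵥ v)) ∧ ∀ v, c * (v ⬝ᵥ P *ᵥ v) ≤ v ⬝ᵥ P *ᵥ A *ᵥ v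

theorem HasLyapunovForm.mono {A : Matrix ι ι ℝ} {m M c m' M' c' : ℝ}
    (h : HasLyapunovForm A m M c) (hm : 0 ≤ m) (hm' : m' ≤ m) (hM : M ≤ M') (hc : c' ≤ c) :
    HasLyapunovForm A m' M' c' := by
  obtain ⟨P, hs, hl, hu, hd⟩ := h
  have hvv : ∀ v : ι → ℝ, 0 ≤ v ⬝ᵥ v := fun v ↦ by
    simpa using dotProduct_star_self_nonneg v
  refine ⟨P, hs, fun v ↦ ?_, fun v ↦ ?_, fun v ↦ ?_⟩
  · exact (mul_le_mul_of_nonneg_right hm' (hvv v)).trans (hl v)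
  · exact (hu v).trans (mul_le_mul_of_nonneg_right hM (hvv v))
  · exact (mul_le_mul_of_nonneg_right hc ((mul_nonneg hm (hvv v)).trans (hl v))).trans (hd v)

/-- A continuous family of positive definite forms with semidefinite dissipation yields uniform
Lyapunov forms as soon as a perturbation `Y` dissipates on the kernel of the dissipation. -/
theorem exists_forall_hasLyapunovForm {K : Set ℝ} (hK : IsCompact K)
    {A P Y : ℝ → Matrix ι ι ℝ} (hA : ContinuousOn A K) (hP : ContinuousOn P K)
    (hY : ContinuousOn Y K) (hPs : ∀ r ∈ K, (P r).IsSymm) (hYs : ∀ r ∈ K, (Y r).IsSymm)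
    (hP0 : ∀ r ∈ K, ∀ v, v ≠ 0 → 0 < v ⬝ᵥ P r *ᵥ v)
    (hPA : ∀ r ∈ K, ∀ v, 0 ≤ v ⬝ᵥ P r *ᵥ A r *ᵥ v)
    (hYA : ∀ r ∈ K, ∀ v, v ≠ 0 → v ⬝ᵥ P r *ᵥ A r *ᵥ v = 0 → 0 < v ⬝ᵥ Y r *ᵥ A r *ᵥ v) :
    ∃ m M c : ℝ, 0 < m ∧ 0 < M ∧ 0 < c ∧ ∀ r ∈ K, HasLyapunovForm (A r) m M c := by
  classical
  have hnonneg : ∀ Q : ℝ → Matrix ι ι ℝ, (∀ r ∈ K, ∀ v, v ≠ 0 → 0 < v ⬝ᵥ Q r *ᵥ v) →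
      ∀ r ∈ K, ∀ v, 0 ≤ v ⬝ᵥ Q r *ᵥ v := fun Q hQ r hr v ↦ by
    rcases eq_or_ne v 0 with rfl | hv
    · simp
    · exact (hQ r hr v hv).le
  obtain ⟨δ₁, hδ₁, h₁⟩ := exists_forall_dotProduct_add_smul_pos hK hP hY (hnonneg P hP0)
    fun r hr v hv h ↦ absurd h (hP0 r hr v hv).ne'
  obtain ⟨δ₂, hδ₂, h₂⟩ := exists_forall_dotProduct_add_smul_pos hK
    (P := fun r ↦ P r * A r) (Q := fun r ↦ Y r * A r) (hP.mul hA) (hY.mul hA)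
    (by simpa only [← mulVec_mulVec] using hPA) (by simpa only [← mulVec_mulVec] using hYA)
  set ε := min δ₁ δ₂
  have hε : 0 < ε := lt_min hδ₁ hδ₂
  set L : ℝ → Matrix ι ι ℝ := fun r ↦ P r + ε • Y r with hL
  have hLc : ContinuousOn L K := hP.add (hY.const_smul ε)
  have hLpos : ∀ r ∈ K, ∀ v, v ≠ 0 → 0 < v ⬝ᵥ L r *ᵥ v := fun r hr v hv ↦ by
    simpa [hL, add_mulVec, smul_mulVec] using h₁ ε hε (min_le_left _ _) r hr v hv
  have hLApos : ∀ r ∈ K, ∀ v, v ≠ 0 → 0 < v ⬝ᵥ (L r * A r) *ᵥ v := fun r hr v hv ↦ by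
    simpa [hL, add_mulVec, smul_mulVec, add_mul] using h₂ ε hε (min_le_right _ _) r hr v hv
  have hcmp : ∀ Q R : ℝ → Matrix ι ι ℝ, ContinuousOn Q K → ContinuousOn R K →
      (∀ r ∈ K, ∀ v, v ≠ 0 → 0 < v ⬝ᵥ Q r *ᵥ v) →
      ∃ m > 0, ∀ r ∈ K, ∀ v, m * (v ⬝ᵥ R r *ᵥ v) ≤ v ⬝ᵥ Q r *ᵥ v := fun Q R hQ hR hpos ↦ by
    obtain ⟨m, hm, h⟩ := exists_forall_dotProduct_add_smul_pos hK hQ hR.neg (hnonneg Q hpos)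
      fun r hr v hv h ↦ absurd h (hpos r hr v hv).ne'
    refine ⟨m, hm, fun r hr v ↦ ?_⟩
    rcases eq_or_ne v 0 with rfl | hv
    · simp
    · have := h m hm le_rfl r hr v hv
      simp only [Pi.neg_apply, neg_mulVec, dotProduct_neg] at this
      linarith
  have h1 : ContinuousOn (fun _ : ℝ ↦ (1 : Matrix ι ι ℝ)) K := continuousOn_const
  obtain ⟨m, hm, hmL⟩ := hcmp L _ hLc h1 hLpos
  obtain ⟨M, hM, hML⟩ := hcmp _ L h1 hLc fun r _ v hv ↦ by
    simpa using dotProduct_star_self_pos_iff.2 hv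
  obtain ⟨c, hc, hcL⟩ := hcmp _ L (hLc.mul hA) hLc hLApos
  refine ⟨m, M⁻¹, c, hm, by positivity, hc, fun r hr ↦
    ⟨L r, ?_, fun v ↦ ?_, fun v ↦ ?_, fun v ↦ ?_⟩⟩
  · exact (hPs r hr).add ((hYs r hr).smul ε)
  · simpa using hmL r hr v
  · rw [le_inv_mul_iff₀ hM]
    simpa using hML r hr v
  · simpa using hcL r hr v

end QuadraticForms

/-- If `w ≥ 0` satisfies `w′ ≤ 2 √w g`, then `√w` grows at most by the integral of `g`. -/
theorem sqrt_le_sqrt_add_integral {w w' g : ℝ → ℝ} (hw : ∀ t, 0 ≤ w t)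
    (hg : ContinuousOn g (Ici 0)) (hg0 : ∀ t, 0 ≤ t → 0 ≤ g t)
    (hd : ∀ t ∈ Ici (0 : ℝ), HasDerivWithinAt w (w' t) (Ici 0) t)
    (hle : ∀ t, 0 ≤ t → w' t ≤ 2 * √(w t) * g t) {t : ℝ} (ht : 0 ≤ t) :
    √(w t) ≤ √(w 0) + ∫ τ in (0 : ℝ)..t, g τ := by
  have key : ∀ δ : ℝ, 0 < δ → √(w t + δ) - ∫ τ in (0 : ℝ)..t, g τ ≤ √(w 0 + δ) := by
    intro δ hδ
    have hpos : ∀ s, w s + δ ≠ 0 := fun s ↦ (add_pos_of_nonneg_of_pos (hw s) hδ).ne'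
    have hanti : AntitoneOn (fun s ↦ √(w s + δ) - ∫ τ in (0 : ℝ)..s, g τ) (Icc 0 t) := by
      refine antitoneOn_of_hasDerivWithinAt_nonpos (convex_Icc 0 t)
        (f' := fun s ↦ w' s / (2 * √(w s + δ)) - g s) (ContinuousOn.sub ?_ ?_) ?_ ?_
      · have hwc : ContinuousOn w (Icc 0 t) := fun s hs ↦
          (hd s hs.1).continuousWithinAt.mono Icc_subset_Ici_self
        exact (hwc.add continuousOn_const).sqrt
      · have := intervalIntegral.continuousOn_primitive_interval (μ := volume) (f := g)
          (a := 0) (b := t) ?_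
        · rwa [uIcc_of_le ht] at this
        · rw [uIcc_of_le ht]
          exact (hg.mono Icc_subset_Ici_self).integrableOn_Icc
      · intro s hs
        rw [interior_Icc] at hs ⊢
        have hnhds : Ici (0 : ℝ) ∈ nhds s := Ici_mem_nhds hs.1
        have h1 : HasDerivAt (fun s ↦ √(w s + δ)) (w' s / (2 * √(w s + δ))) s :=
          (((hd s hs.1.le).hasDerivAt hnhds).add_const δ).sqrt (hpos s)
        have h2 : HasDerivAt (fun s ↦ ∫ τ in (0 : ℝ)..s, g τ) (g s) s := by
          refine intervalIntegral.integral_hasDerivAt_right ?_ ?_ (hg.continuousAt hnhds)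
          · refine ContinuousOn.intervalIntegrable (hg.mono ?_)
            rw [uIcc_of_le hs.1.le]
            exact Icc_subset_Ici_self
          · exact (hg.mono Ioi_subset_Ici_self).stronglyMeasurableAtFilter isOpen_Ioi s hs.1
        exact (h1.sub h2).hasDerivWithinAt
      · intro s hs
        rw [interior_Icc] at hs
        have hs0 : 0 < √(w s + δ) := Real.sqrt_pos.2 (add_pos_of_nonneg_of_pos (hw s) hδ)
        rw [sub_nonpos, div_le_iff₀ (by positivity)]
        have h1 : √(w s) ≤ √(w s + δ) := Real.sqrt_le_sqrt (by linarith)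
        have h2 := mul_le_mul_of_nonneg_right h1 (hg0 s hs.1.le)
        linarith [hle s hs.1.le]
    simpa using hanti (left_mem_Icc.2 ht) (right_mem_Icc.2 ht) ht
  have hlim : ∀ s, Filter.Tendsto (fun δ ↦ √(w s + δ)) (nhdsWithin 0 (Ioi 0)) (nhds √(w s)) := by
    intro s
    have : Continuous fun δ ↦ √(w s + δ) := by fun_prop
    simpa using (this.tendsto 0).mono_left nhdsWithin_le_nhds
  have := le_of_tendsto_of_tendsto ((hlim t).sub_const _) (hlim 0)
    (Filter.eventually_of_mem self_mem_nhdsWithin key)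
  linarith

/-- A Lyapunov form turns into a Duhamel estimate for the forced system. -/
theorem HasLyapunovForm.duhamel {ι : Type*} [Fintype ι] {A : Matrix ι ι ℝ} {m M c : ℝ}
    (h : HasLyapunovForm A m M c) (hm : 0 < m) (hM : 0 < M) {V F : ℝ → ι → ℝ}
    (hF : ContinuousOn F (Ici 0))
    (hV : ∀ t ∈ Ici (0 : ℝ), HasDerivWithinAt V (-(A *ᵥ V t) + F t) (Ici 0) t)
    {t : ℝ} (ht : 0 ≤ t) :
    √(V t ⬝ᵥ V t) ≤ √(M / m) * Real.exp (-c * t) * √(V 0 ⬝ᵥ V 0)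
      + √(M / m) * ∫ τ in (0 : ℝ)..t, Real.exp (-c * (t - τ)) * √(F τ ⬝ᵥ F τ) := by
  obtain ⟨P, hs, hl, hu, hd⟩ := h
  have hvv : ∀ v : ι → ℝ, 0 ≤ v ⬝ᵥ v := fun v ↦ by
    simpa using dotProduct_star_self_nonneg v
  have hP0 : ∀ v, 0 ≤ v ⬝ᵥ P *ᵥ v := fun v ↦ (mul_nonneg hm.le (hvv v)).trans (hl v)
  have hcomm : ∀ v w, v ⬝ᵥ P *ᵥ w = w ⬝ᵥ P *ᵥ v := fun v w ↦ by
    rw [dotProduct_mulVec, ← mulVec_transpose, hs.eq, dotProduct_comm]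
  have hVi : ∀ s ∈ Ici (0 : ℝ), ∀ i,
      HasDerivWithinAt (fun s ↦ V s i) ((-(A *ᵥ V s) + F s) i) (Ici 0) s := fun s hs ↦
    hasDerivWithinAt_pi.1 (hV s hs)
  have hform : ∀ s ∈ Ici (0 : ℝ), HasDerivWithinAt (fun s ↦ V s ⬝ᵥ P *ᵥ V s)
      (2 * (V s ⬝ᵥ P *ᵥ (-(A *ᵥ V s) + F s))) (Ici 0) s := by
    intro s hs
    have h1 : HasDerivWithinAt (fun s ↦ V s ⬝ᵥ P *ᵥ V s)
        ((-(A *ᵥ V s) + F s) ⬝ᵥ P *ᵥ V s + V s ⬝ᵥ P *ᵥ (-(A *ᵥ V s) + F s)) (Ici 0) s := by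
      simp only [dotProduct, mulVec, ← Finset.sum_add_distrib]
      exact HasDerivWithinAt.fun_sum fun i _ ↦ (hVi s hs i).mul
        (HasDerivWithinAt.fun_sum fun j _ ↦ (hVi s hs j).const_mul (P i j))
    convert h1 using 1
    rw [hcomm (-(A *ᵥ V s) + F s)]
    ring
  have hexp : ∀ s, HasDerivAt (fun s ↦ Real.exp (2 * c * s)) (Real.exp (2 * c * s) * (2 * c)) s :=
    fun s ↦ by simpa using ((hasDerivAt_id s).const_mul (2 * c)).exp
  have hsq : ∀ s, √(Real.exp (2 * c * s)) = Real.exp (c * s) := fun s ↦ by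
    rw [Real.sqrt_eq_iff_mul_self_eq (Real.exp_pos _).le (Real.exp_pos _).le, ← Real.exp_add]
    ring_nf
  have hFc : ContinuousOn (fun τ ↦ √(F τ ⬝ᵥ F τ)) (Ici 0) := by
    have : ∀ i, ContinuousOn (fun τ ↦ F τ i) (Ici 0) := continuousOn_pi.1 hF
    simp only [dotProduct]
    fun_prop
  have hgrow := sqrt_le_sqrt_add_integral
    (w := fun s ↦ Real.exp (2 * c * s) * (V s ⬝ᵥ P *ᵥ V s))
    (g := fun s ↦ Real.exp (c * s) * (√M * √(F s ⬝ᵥ F s)))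
    (fun s ↦ mul_nonneg (Real.exp_pos _).le (hP0 _))
    (ContinuousOn.mul (by fun_prop) (continuousOn_const.mul hFc))
    (fun s _ ↦ by positivity)
    (fun s hs ↦ (hexp s).hasDerivWithinAt.mul (hform s hs)) ?_ ht
  · simp only [Real.sqrt_mul (Real.exp_pos _).le, hsq, mul_zero, Real.exp_zero, one_mul] at hgrow
    have hlow : √m * √(V t ⬝ᵥ V t) ≤ √(V t ⬝ᵥ P *ᵥ V t) := by
      rw [← Real.sqrt_mul hm.le]
      exact Real.sqrt_le_sqrt (hl _)
    have hup : √(V 0 ⬝ᵥ P *ᵥ V 0) ≤ √M * √(V 0 ⬝ᵥ V 0) := by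
      rw [← Real.sqrt_mul hM.le]
      exact Real.sqrt_le_sqrt (hu _)
    have hint : ∫ τ in (0 : ℝ)..t, Real.exp (c * τ) * (√M * √(F τ ⬝ᵥ F τ)) =
        Real.exp (c * t) * √M *
          ∫ τ in (0 : ℝ)..t, Real.exp (-c * (t - τ)) * √(F τ ⬝ᵥ F τ) := by
      rw [← intervalIntegral.integral_const_mul]
      congr 1 with τ
      have : Real.exp (c * τ) = Real.exp (c * t) * Real.exp (-c * (t - τ)) := by
        rw [← Real.exp_add]
        ring_nf
      rw [this]
      ring
    rw [hint] at hgrow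
    have hm' : 0 < √m := Real.sqrt_pos.2 hm
    have hneg : Real.exp (-c * t) = (Real.exp (c * t))⁻¹ := by rw [← Real.exp_neg]; ring_nf
    have hchain : Real.exp (c * t) * (√m * √(V t ⬝ᵥ V t)) ≤ √M * √(V 0 ⬝ᵥ V 0) +
        Real.exp (c * t) * √M *
          ∫ τ in (0 : ℝ)..t, Real.exp (-c * (t - τ)) * √(F τ ⬝ᵥ F τ) :=
      (mul_le_mul_of_nonneg_left hlow (Real.exp_pos _).le).trans
        (hgrow.trans (add_le_add_left hup _))
    rw [Real.sqrt_div hM.le, hneg]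
    have he := Real.exp_pos (c * t)
    rw [← mul_le_mul_iff_right₀ (mul_pos he hm')]
    refine Eq.trans_le (by ring) (hchain.trans_eq ?_)
    field_simp
  · intro s _
    have hdiss := hd (V s)
    have hcs : V s ⬝ᵥ P *ᵥ F s ≤ √(V s ⬝ᵥ P *ᵥ V s) * (√M * √(F s ⬝ᵥ F s)) := by
      rw [← Real.sqrt_mul hM.le, ← Real.sqrt_mul (hP0 _)]
      exact Real.le_sqrt_of_sq_le ((sq_dotProduct_mulVec_le hs hP0 _ _).trans
        (mul_le_mul_of_nonneg_left (hu _) (hP0 _)))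
    have hee : Real.exp (2 * c * s) = Real.exp (c * s) * Real.exp (c * s) := by
      rw [← Real.exp_add]
      ring_nf
    rw [Real.sqrt_mul (Real.exp_pos _).le, hsq, mulVec_add, mulVec_neg, dotProduct_add,
      dotProduct_neg, hee]
    have := mul_le_mul_of_nonneg_left
      (show c * (V s ⬝ᵥ P *ᵥ V s) + (-(V s ⬝ᵥ P *ᵥ A *ᵥ V s) + V s ⬝ᵥ P *ᵥ F s)
        ≤ √(V s ⬝ᵥ P *ᵥ V s) * (√M * √(F s ⬝ᵥ F s)) by linarith)
      (mul_pos (Real.exp_pos (c * s)) (Real.exp_pos (c * s))).le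
    linarith

/-- The energy form, which dissipates away from low frequencies. -/
def energyForm : Matrix (Fin 5) (Fin 5) ℝ :=
  !![1, 0, 0, 0,   0;
     0, 1, 0, 0,   0;
     0, 0, 1, 0,   0;
     0, 0, 0, 1/4, 0;
     0, 0, 0, 0,   1/4]

/-- The form `ρ² + u² + (θ + I)² + (4θ - I)² / 4 + 5 (q / r - I)² / 4`, which dissipates at low
frequencies. -/
def lowFrequencyForm (r : ℝ) : Matrix (Fin 5) (Fin 5) ℝ :=
  !![1, 0, 0, 0,          0;
     0, 1, 0, 0,          0;
     0, 0, 5, 0,          0;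
     0, 0, 0, 5/2,        -5/(4*r);
     0, 0, 0, -5/(4*r),   5/(4*r^2)]

/-- The form `-2 ρ u`, which dissipates in the direction of `ρ`. -/
def crossForm : Matrix (Fin 5) (Fin 5) ℝ :=
  !![0,  -1, 0, 0, 0;
     -1, 0,  0, 0, 0;
     0,  0,  0, 0, 0;
     0,  0,  0, 0, 0;
     0,  0,  0, 0, 0]

theorem crossForm_isSymm : crossForm.IsSymm := by
  ext i j
  fin_cases i <;> fin_cases j <;> rfl

theorem energyForm_isSymm : energyForm.IsSymm := by
  ext i j
  fin_cases i <;> fin_cases j <;> rfl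

theorem lowFrequencyForm_isSymm (r : ℝ) : (lowFrequencyForm r).IsSymm := by
  ext i j
  fin_cases i <;> fin_cases j <;> rfl

theorem continuous_Amat : Continuous Amat := by
  refine continuous_matrix fun i j ↦ ?_
  fin_cases i <;> fin_cases j <;> simp [Amat] <;> fun_prop

theorem continuousOn_lowFrequencyForm {K : Set ℝ} (hK : ∀ r ∈ K, 0 < r) :
    ContinuousOn lowFrequencyForm K := by
  have h : ∀ r ∈ K, 4 * r ≠ 0 := fun r hr ↦ (mul_pos four_pos (hK r hr)).ne'
  have h' : ∀ r ∈ K, 4 * r ^ 2 ≠ 0 := fun r hr ↦ (mul_pos four_pos (pow_pos (hK r hr) 2)).ne'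
  refine continuousOn_pi.2 fun i ↦ continuousOn_pi.2 fun j ↦ ?_
  fin_cases i <;> fin_cases j <;> simp only [lowFrequencyForm] <;>
    first
    | exact continuousOn_const
    | exact continuousOn_const.div (by fun_prop) h
    | exact continuousOn_const.div (by fun_prop) h'

theorem eq_zero_of_coords {v : Fin 5 → ℝ} (h0 : v 0 = 0) (h1 : v 1 = 0) (h2 : v 2 = 0)
    (h3 : v 3 = 0) (h4 : v 4 = 0) : v = 0 := by
  ext i
  fin_cases i <;> assumption

theorem crossForm_dissipation_pos {r : ℝ} (hr : 0 < r) {v : Fin 5 → ℝ} (hv : v ≠ 0)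
    (h1 : v 1 = 0) (h2 : v 2 = 0) (h3 : v 3 = 0) (h4 : v 4 = 0) :
    0 < v ⬝ᵥ crossForm *ᵥ Amat r *ᵥ v := by
  have h0 : v 0 ≠ 0 := fun h0 ↦ hv (eq_zero_of_coords h0 h1 h2 h3 h4)
  have : v ⬝ᵥ crossForm *ᵥ Amat r *ᵥ v = r * v 0 ^ 2 := by
    simp [dotProduct, mulVec, Fin.sum_univ_five, crossForm, Amat, h1, h2, h3, h4]
    ring
  rw [this]
  positivity

theorem energyForm_pos {v : Fin 5 → ℝ} (hv : v ≠ 0) : 0 < v ⬝ᵥ energyForm *ᵥ v := by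
  have h : v ⬝ᵥ energyForm *ᵥ v =
      v 0 ^ 2 + v 1 ^ 2 + v 2 ^ 2 + v 3 ^ 2 / 4 + v 4 ^ 2 / 4 := by
    simp [dotProduct, mulVec, Fin.sum_univ_five, energyForm]
    ring
  rw [h]
  refine lt_of_le_of_ne' (by positivity) fun h0 ↦ hv ?_
  apply eq_zero_of_coords <;> refine pow_eq_zero_iff two_ne_zero |>.1 ?_ <;>
    linarith [sq_nonneg (v 0), sq_nonneg (v 1), sq_nonneg (v 2), sq_nonneg (v 3), sq_nonneg (v 4)]

theorem lowFrequencyForm_pos {r : ℝ} (hr : 0 < r) {v : Fin 5 → ℝ} (hv : v ≠ 0) :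
    0 < v ⬝ᵥ lowFrequencyForm r *ᵥ v := by
  have h : v ⬝ᵥ lowFrequencyForm r *ᵥ v =
      v 0 ^ 2 + v 1 ^ 2 + 5 * v 2 ^ 2 + 5 / 4 * v 3 ^ 2 + 5 / 4 * (v 4 / r - v 3) ^ 2 := by
    simp [dotProduct, mulVec, Fin.sum_univ_five, lowFrequencyForm]
    field_simp
    ring
  rw [h]
  refine lt_of_le_of_ne' (by positivity) fun h0 ↦ hv ?_
  have hsq := sq_nonneg (v 4 / r - v 3)
  have h3 : v 3 = 0 := pow_eq_zero_iff two_ne_zero |>.1 <| by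
    linarith [sq_nonneg (v 0), sq_nonneg (v 1), sq_nonneg (v 2), sq_nonneg (v 3)]
  have h4 : v 4 / r - v 3 = 0 := pow_eq_zero_iff two_ne_zero |>.1 <| by
    linarith [sq_nonneg (v 0), sq_nonneg (v 1), sq_nonneg (v 2), sq_nonneg (v 3)]
  rw [h3, sub_zero, div_eq_zero_iff, or_iff_left hr.ne'] at h4
  refine eq_zero_of_coords ?_ ?_ ?_ h3 h4 <;> refine pow_eq_zero_iff two_ne_zero |>.1 ?_ <;>
    linarith [sq_nonneg (v 0), sq_nonneg (v 1), sq_nonneg (v 2), sq_nonneg (v 3)]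

theorem energyForm_dissipation {r : ℝ} (v : Fin 5 → ℝ) :
    v ⬝ᵥ energyForm *ᵥ Amat r *ᵥ v = 3 * r ^ 2 * v 1 ^ 2 - v 1 * v 4 + v 4 ^ 2 / 4
      + r ^ 2 * v 2 ^ 2 + (2 * v 2 - v 3 / 2) ^ 2 := by
  simp [dotProduct, mulVec, Fin.sum_univ_five, energyForm, Amat]
  ring

theorem energyForm_dissipation_ge {r : ℝ} (hr : 2 / 5 ≤ r ^ 2) (v : Fin 5 → ℝ) :
    (v 1 ^ 2 + v 4 ^ 2) / 100 + r ^ 2 * v 2 ^ 2 + (2 * v 2 - v 3 / 2) ^ 2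
      ≤ v ⬝ᵥ energyForm *ᵥ Amat r *ᵥ v := by
  rw [energyForm_dissipation]
  nlinarith [sq_nonneg (v 1 - 12 / 25 * v 4), mul_nonneg (sub_nonneg.2 hr) (sq_nonneg (v 1)),
    sq_nonneg (v 1), sq_nonneg (v 4)]

theorem lowFrequencyForm_dissipation {r : ℝ} (hr : 0 < r) (v : Fin 5 → ℝ) :
    v ⬝ᵥ lowFrequencyForm r *ᵥ Amat r *ᵥ v = 3 * (r * v 1) ^ 2 + r ^ 2 * (v 2 + v 3) ^ 2
      + (5 + r ^ 2) / 4 * (4 * v 2 - v 3) ^ 2 + 5 / 4 * (1 - r ^ 2) * (v 4 / r - v 3) ^ 2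
      + r * v 1 * (4 * v 2 - v 3 - (v 4 / r - v 3))
      + 5 / 4 * (v 4 / r - v 3) * (4 * v 2 - v 3) := by
  simp [dotProduct, mulVec, Fin.sum_univ_five, lowFrequencyForm, Amat]
  field_simp
  ring

theorem lowFrequencyForm_dissipation_ge {r : ℝ} (hr : 0 < r) (hr' : r ^ 2 ≤ 2 / 5)
    (v : Fin 5 → ℝ) :
    ((r * v 1) ^ 2 + (4 * v 2 - v 3) ^ 2 + (v 4 / r - v 3) ^ 2) / 100 + r ^ 2 * (v 2 + v 3) ^ 2
      ≤ v ⬝ᵥ lowFrequencyForm r *ᵥ Amat r *ᵥ v := by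
  rw [lowFrequencyForm_dissipation hr]
  generalize r * v 1 = a
  generalize 4 * v 2 - v 3 = z
  generalize v 4 / r - v 3 = f
  nlinarith [sq_nonneg (29 / 5 * a + z - f), sq_nonneg (z + 5 / 8 * f), sq_nonneg f, sq_nonneg z,
    sq_nonneg a, mul_nonneg (sub_nonneg.2 hr') (sq_nonneg f), mul_nonneg (sq_nonneg r) (sq_nonneg z)]

theorem exists_forall_hasLyapunovForm_high {K : Set ℝ} (hK : IsCompact K)
    (hpos : ∀ r ∈ K, 0 < r) (hhigh : ∀ r ∈ K, 2 / 5 ≤ r ^ 2) :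
    ∃ m M c : ℝ, 0 < m ∧ 0 < M ∧ 0 < c ∧ ∀ r ∈ K, HasLyapunovForm (Amat r) m M c := by
  refine exists_forall_hasLyapunovForm hK (P := fun _ ↦ energyForm) (Y := fun _ ↦ crossForm)
    continuous_Amat.continuousOn continuousOn_const continuousOn_const
    (fun _ _ ↦ energyForm_isSymm) (fun _ _ ↦ crossForm_isSymm) (fun _ _ _ ↦ energyForm_pos)
    (fun r hr v ↦ (by positivity : (0 : ℝ) ≤ _).trans (energyForm_dissipation_ge (hhigh r hr) v))
    fun r hr v hv h ↦ ?_
  have hr0 := hpos r hr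
  have hge := energyForm_dissipation_ge (hhigh r hr) v
  rw [h] at hge
  have ha := sq_nonneg (v 1)
  have hb := sq_nonneg (v 4)
  have hc := mul_nonneg (sq_nonneg r) (sq_nonneg (v 2))
  have hd := sq_nonneg (2 * v 2 - v 3 / 2)
  have h2 : r ^ 2 * v 2 ^ 2 = 0 := by linarith
  have h3 : 2 * v 2 - v 3 / 2 = 0 := pow_eq_zero_iff two_ne_zero |>.1 (by linarith)
  have h2' : v 2 = 0 := by simpa [hr0.ne'] using h2
  exact crossForm_dissipation_pos hr0 hv (pow_eq_zero_iff two_ne_zero |>.1 (by linarith)) h2'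
    (by linarith) (pow_eq_zero_iff two_ne_zero |>.1 (by linarith))

theorem exists_forall_hasLyapunovForm_low {K : Set ℝ} (hK : IsCompact K)
    (hpos : ∀ r ∈ K, 0 < r) (hlow : ∀ r ∈ K, r ^ 2 ≤ 2 / 5) :
    ∃ m M c : ℝ, 0 < m ∧ 0 < M ∧ 0 < c ∧ ∀ r ∈ K, HasLyapunovForm (Amat r) m M c := by
  refine exists_forall_hasLyapunovForm hK (P := lowFrequencyForm) (Y := fun _ ↦ crossForm)
    continuous_Amat.continuousOn (continuousOn_lowFrequencyForm hpos) continuousOn_const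
    (fun r _ ↦ lowFrequencyForm_isSymm r) (fun _ _ ↦ crossForm_isSymm)
    (fun r hr _ ↦ lowFrequencyForm_pos (hpos r hr))
    (fun r hr v ↦ (by positivity : (0 : ℝ) ≤ _).trans
      (lowFrequencyForm_dissipation_ge (hpos r hr) (hlow r hr) v))
    fun r hr v hv h ↦ ?_
  have hr0 := hpos r hr
  have hge := lowFrequencyForm_dissipation_ge hr0 (hlow r hr) v
  rw [h] at hge
  have ha := sq_nonneg (r * v 1)
  have hb := sq_nonneg (4 * v 2 - v 3)
  have hc := sq_nonneg (v 4 / r - v 3)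
  have hd := mul_nonneg (sq_nonneg r) (sq_nonneg (v 2 + v 3))
  have h1 : r * v 1 = 0 := pow_eq_zero_iff two_ne_zero |>.1 (by linarith)
  have hz : 4 * v 2 - v 3 = 0 := pow_eq_zero_iff two_ne_zero |>.1 (by linarith)
  have hf : v 4 / r - v 3 = 0 := pow_eq_zero_iff two_ne_zero |>.1 (by linarith)
  have hE : r ^ 2 * (v 2 + v 3) ^ 2 = 0 := by linarith
  have hE' : v 2 + v 3 = 0 := by simpa [hr0.ne'] using hE
  have h3 : v 3 = 0 := by linarith
  rw [h3, sub_zero, div_eq_zero_iff, or_iff_left hr0.ne'] at hf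
  exact crossForm_dissipation_pos hr0 hv (by simpa [hr0.ne'] using h1) (by linarith) h3 hf

theorem exists_forall_hasLyapunovForm_Amat {K : Set ℝ} (hK : IsCompact K)
    (hpos : ∀ r ∈ K, 0 < r) :
    ∃ m M c : ℝ, 0 < m ∧ 0 < M ∧ 0 < c ∧ ∀ r ∈ K, HasLyapunovForm (Amat r) m M c := by
  have hcont : Continuous fun r : ℝ ↦ r ^ 2 := by fun_prop
  obtain ⟨m₁, M₁, c₁, hm₁, hM₁, hc₁, h₁⟩ := exists_forall_hasLyapunovForm_low
    (hK.inter_right (isClosed_Iic.preimage hcont : IsClosed {r : ℝ | r ^ 2 ≤ 2 / 5}))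
    (fun r hr ↦ hpos r hr.1) fun r hr ↦ hr.2
  obtain ⟨m₂, M₂, c₂, hm₂, hM₂, hc₂, h₂⟩ := exists_forall_hasLyapunovForm_high
    (hK.inter_right (isClosed_Ici.preimage hcont : IsClosed {r : ℝ | 2 / 5 ≤ r ^ 2}))
    (fun r hr ↦ hpos r hr.1) fun r hr ↦ hr.2
  refine ⟨min m₁ m₂, max M₁ M₂, min c₁ c₂, lt_min hm₁ hm₂, lt_max_of_lt_left hM₁, lt_min hc₁ hc₂,
    fun r hr ↦ ?_⟩
  rcases le_total (r ^ 2) (2 / 5) with h | h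
  · exact (h₁ r ⟨hr, h⟩).mono hm₁.le (min_le_left _ _) (le_max_left _ _) (min_le_left _ _)
  · exact (h₂ r ⟨hr, h⟩).mono hm₂.le (min_le_right _ _) (le_max_right _ _) (min_le_right _ _)

/-- **Duhamel estimate in the medium-frequency regime** (equation (3.82)): for
`0 < r₀ ≤ R₀` there are `C, c₁ > 0` such that every `C¹` solution `V` of
`V′ = −𝒜(r)V + F` on `[0,∞)` with `F` continuous satisfies
`‖V(t)‖ ≤ C e^{−c₁ t}‖V(0)‖ + C ∫₀ᵗ e^{−c₁(t−τ)} ‖F(τ)‖ dτ` (Euclidean norms). -/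
theorem duhamel_medium_frequency (r₀ R₀ : ℝ) (h₀ : 0 < r₀) (hle : r₀ ≤ R₀) :
    ∃ C c₁ : ℝ, 0 < C ∧ 0 < c₁ ∧
      ∀ r : ℝ, r₀ ≤ r → r ≤ R₀ →
      ∀ V F : ℝ → Fin 5 → ℝ,
        ContinuousOn F (Ici 0) →
        (∀ t ∈ Ici (0:ℝ),
          HasDerivWithinAt V (fun i => -((Amat r).mulVec (V t) i) + F t i) (Ici 0) t) →
        ∀ t : ℝ, 0 ≤ t →
          Real.sqrt (∑ i, (V t i) ^ 2) ≤
            C * Real.exp (-c₁ * t) * Real.sqrt (∑ i, (V 0 i) ^ 2)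
              + C * ∫ τ in Icc (0:ℝ) t,
                  Real.exp (-c₁ * (t - τ)) * Real.sqrt (∑ i, (F τ i) ^ 2) := by
  obtain ⟨m, M, c, hm, hM, hc, h⟩ := exists_forall_hasLyapunovForm_Amat
    (isCompact_Icc (a := r₀) (b := R₀)) fun r hr ↦ h₀.trans_le hr.1
  refine ⟨√(M / m), c, Real.sqrt_pos.2 (div_pos hM hm), hc, fun r hr hr' V F hF hV t ht ↦ ?_⟩
  have := (h r ⟨hr, hr'⟩).duhamel hm hM hF hV ht
  simpa only [dotProduct, ← sq, intervalIntegral.integral_of_le ht,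
    ← integral_Icc_eq_integral_Ioc] using this
end
end

section
/- There exist r* > 0 and C > 0 such that for every r with 0 < r < r*, the five roots (with multiplicity) y₁, y₂, y₃, y₄, y₅ ∈ ℂ of the quintic y⁵ + (4r²+6)y⁴ + (3r⁴+23r²+5)y³ + (11r⁴+28r²)y² + (3r⁶+19r⁴+10r²)y + (r⁶+5r⁴) = 0 can be labeled so that |y₁ + 5 + (11/20)r²| ≤ C r⁴, |y₂ + 1 + (1/4)r²| ≤ C r⁴, |y₃ + (1/2)r²| ≤ C r⁴, |y₄ + (27/20)r² + i√2 r| ≤ C r³, and |y₅ + (27/20)r² − i√2 r| ≤ C r³. -/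
noncomputable section

/-- The characteristic quintic as a function of `s = r²`. -/
def quintic (s y : ℝ) : ℝ :=
  y^5 + (4*s+6) * y^4 + (3*s^2+23*s+5) * y^3 + (11*s^2+28*s) * y^2
    + (3*s^3+19*s^2+10*s) * y + (s^3+5*s^2)

lemma exists_root_near {f : ℝ → ℝ} (hf : Continuous f) {x d : ℝ} (hd : 0 ≤ d)
    (h₁ : f (x - d) ≤ 0) (h₂ : 0 ≤ f (x + d)) : ∃ e, |e| ≤ d ∧ f (x + e) = 0 := by
  obtain ⟨y, ⟨hy₁, hy₂⟩, hy⟩ := intermediate_value_Icc (by linarith : x - d ≤ x + d)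
    hf.continuousOn ⟨h₁, h₂⟩
  exact ⟨y - x, abs_le.2 ⟨by linarith, by linarith⟩, by simpa using hy⟩

lemma continuous_quintic (s : ℝ) : Continuous (quintic s) := by
  unfold quintic
  fun_prop

lemma pow_succ_le_of_small {s : ℝ} (hs : 0 < s) (hs' : s < 1/1000) (k : ℕ) :
    0 ≤ s^k ∧ s^(k+1) ≤ 1/1000 * s^k := by
  have h : 0 ≤ s^k := by positivity
  refine ⟨h, ?_⟩
  rw [pow_succ']
  exact mul_le_mul_of_nonneg_right hs'.le h

lemma exists_quintic_root_near_five {s : ℝ} (hs : 0 < s) (hs' : s < 1/1000) :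
    ∃ e, |e| ≤ 10*s^2 ∧ quintic s (-5 - 11/20*s + e) = 0 := by
  have hp := pow_succ_le_of_small hs hs'
  refine exists_root_near (continuous_quintic s) (by positivity) ?_ ?_
  all_goals
    unfold quintic
    linarith [(hp 2).1, (hp 2).2, (hp 3).1, (hp 3).2, (hp 4).1, (hp 4).2, (hp 5).1, (hp 5).2,
      (hp 6).1, (hp 6).2, (hp 7).1, (hp 7).2, (hp 8).1, (hp 8).2, (hp 9).1, (hp 9).2, (hp 10).1]

lemma exists_quintic_root_near_one {s : ℝ} (hs : 0 < s) (hs' : s < 1/1000) :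
    ∃ e, |e| ≤ 10*s^2 ∧ quintic s (-1 - 1/4*s + e) = 0 := by
  have hp := pow_succ_le_of_small hs hs'
  suffices h : ∃ e, |e| ≤ 10*s^2 ∧ -quintic s (-1 - 1/4*s + e) = 0 by
    simpa only [neg_eq_zero] using h
  refine exists_root_near (f := fun y => -quintic s y) (continuous_quintic s).neg (by positivity) ?_ ?_
  all_goals
    unfold quintic
    linarith [(hp 2).1, (hp 2).2, (hp 3).1, (hp 3).2, (hp 4).1, (hp 4).2, (hp 5).1, (hp 5).2,
      (hp 6).1, (hp 6).2, (hp 7).1, (hp 7).2, (hp 8).1, (hp 8).2, (hp 9).1, (hp 9).2, (hp 10).1]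

lemma exists_quintic_root_near_zero {s : ℝ} (hs : 0 < s) (hs' : s < 1/1000) :
    ∃ e, |e| ≤ 10*s^2 ∧ quintic s (-(1/2)*s + e) = 0 := by
  have hp := pow_succ_le_of_small hs hs'
  refine exists_root_near (continuous_quintic s) (by positivity) ?_ ?_
  all_goals
    unfold quintic
    linarith [(hp 2).1, (hp 2).2, (hp 3).1, (hp 3).2, (hp 4).1, (hp 4).2, (hp 5).1, (hp 5).2,
      (hp 6).1, (hp 6).2, (hp 7).1, (hp 7).2, (hp 8).1, (hp 8).2, (hp 9).1, (hp 9).2, (hp 10).1]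

/-- Dividing a monic quintic by three linear factors belonging to distinct roots. -/
lemma quintic_eq_mul_of_roots {K : Type*} [Field K] {c₄ c₃ c₂ c₁ c₀ a b c : K}
    (hab : a ≠ b) (hac : a ≠ c) (hbc : b ≠ c)
    (ha : a^5 + c₄*a^4 + c₃*a^3 + c₂*a^2 + c₁*a + c₀ = 0)
    (hb : b^5 + c₄*b^4 + c₃*b^3 + c₂*b^2 + c₁*b + c₀ = 0)
    (hc : c^5 + c₄*c^4 + c₃*c^3 + c₂*c^2 + c₁*c + c₀ = 0) (z : K) :
    z^5 + c₄*z^4 + c₃*z^3 + c₂*z^2 + c₁*z + c₀ =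
      (z - a) * (z - b) * (z - c) * (z^2 + (c₄ + a + b + c) * z +
        (c₃ + c₄*(a+b+c) + (a^2 + b^2 + c^2 + a*b + a*c + b*c))) := by
  have h : (a - b) * (a - c) * (b - c) ≠ 0 := by
    simp [sub_eq_zero, hab, hac, hbc]
  apply mul_left_cancel₀ h
  linear_combination (z - b) * (z - c) * (b - c) * ha - (z - a) * (z - c) * (a - c) * hb
    + (z - a) * (z - b) * (a - b) * hc

lemma abs_sqrt_sub_le {x y : ℝ} (hx : 0 ≤ x) (hy : 0 < y) :
    |√x - y| ≤ |x - y^2| / y := by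
  rw [le_div_iff₀ hy]
  have h : x - y^2 = (√x - y) * (√x + y) := by
    linear_combination -Real.sq_sqrt hx
  rw [h, abs_mul]
  gcongr
  rw [abs_of_pos (by positivity)]
  linarith [Real.sqrt_nonneg x]

/-- **Low-frequency asymptotic expansion of the eigenvalues** (Lemma 3.3, first
part): for small `r > 0` the five roots (with multiplicity) of the quintic
`y⁵ + (4r²+6)y⁴ + (3r⁴+23r²+5)y³ + (11r⁴+28r²)y² + (3r⁶+19r⁴+10r²)y + (r⁶+5r⁴)`
can be labeled `y₁,…,y₅` so that
`y₁ = −5 − (11/20)r² + O(r⁴)`, `y₂ = −1 − (1/4)r² + O(r⁴)`,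
`y₃ = −(1/2)r² + O(r⁴)`, `y₄ = −(27/20)r² − i(√2 r + O(r³))`,
`y₅ = −(27/20)r² + i(√2 r + O(r³))`. -/
theorem eigenvalue_expansion_low_frequency :
    ∃ rstar C : ℝ, 0 < rstar ∧ 0 < C ∧
      ∀ r : ℝ, 0 < r → r < rstar →
        ∃ y₁ y₂ y₃ y₄ y₅ : ℂ,
          (∀ z : ℂ,
            z^5 + ((4*r^2+6 : ℝ) : ℂ) * z^4 + ((3*r^4+23*r^2+5 : ℝ) : ℂ) * z^3
                + ((11*r^4+28*r^2 : ℝ) : ℂ) * z^2 + ((3*r^6+19*r^4+10*r^2 : ℝ) : ℂ) * z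
                + ((r^6+5*r^4 : ℝ) : ℂ)
              = (z - y₁) * (z - y₂) * (z - y₃) * (z - y₄) * (z - y₅)) ∧
          ‖y₁ + ((5 + (11/20)*r^2 : ℝ) : ℂ)‖ ≤ C * r^4 ∧
          ‖y₂ + ((1 + (1/4)*r^2 : ℝ) : ℂ)‖ ≤ C * r^4 ∧
          ‖y₃ + (((1/2)*r^2 : ℝ) : ℂ)‖ ≤ C * r^4 ∧
          ‖y₄ + (((27/20)*r^2 : ℝ) : ℂ) + Complex.I * ((Real.sqrt 2 * r : ℝ) : ℂ)‖ ≤ C * r^3 ∧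
          ‖y₅ + (((27/20)*r^2 : ℝ) : ℂ) - Complex.I * ((Real.sqrt 2 * r : ℝ) : ℂ)‖ ≤ C * r^3 := by
  refine ⟨1/50, 1000, by norm_num, by norm_num, fun r hr hr' => ?_⟩
  obtain ⟨s, hs⟩ : ∃ s, s = r^2 := ⟨_, rfl⟩
  have hs0 : 0 < s := by rw [hs]; positivity
  have hs1 : s < 1/1000 := by nlinarith
  have hp := pow_succ_le_of_small hs0 hs1
  obtain ⟨α, hα, ha⟩ := exists_quintic_root_near_five hs0 hs1
  obtain ⟨β, hβ, hb⟩ := exists_quintic_root_near_one hs0 hs1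
  obtain ⟨γ, hγ, hc⟩ := exists_quintic_root_near_zero hs0 hs1
  have hα' := abs_le.1 hα
  have hβ' := abs_le.1 hβ
  have hγ' := abs_le.1 hγ
  have hp1 := (hp 1).2
  norm_num at hp1
  obtain ⟨a, haα⟩ : ∃ a, a = -5 - 11/20*s + α := ⟨_, rfl⟩
  obtain ⟨b, hbβ⟩ : ∃ b, b = -1 - 1/4*s + β := ⟨_, rfl⟩
  obtain ⟨c, hcγ⟩ : ∃ c, c = -(1/2)*s + γ := ⟨_, rfl⟩
  rw [← haα] at ha
  rw [← hbβ] at hb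
  rw [← hcγ] at hc
  have hab : a < b := by linarith
  have hbc : b < c := by linarith
  obtain ⟨p, hpdef⟩ : ∃ p, p = (4*s+6) + a + b + c := ⟨_, rfl⟩
  obtain ⟨q, hqdef⟩ : ∃ q, q = (3*s^2+23*s+5) + (4*s+6)*(a+b+c)
    + (a^2 + b^2 + c^2 + a*b + a*c + b*c) := ⟨_, rfl⟩
  have hpb : |p - 27/10*s| ≤ 30*s^2 := by
    rw [abs_le]; constructor <;> linarith
  have hpb' := abs_le.1 hpb
  have hqb : |q - 2*s| ≤ 500*s^2 := by
    have key : ∀ x y : ℝ, |x| ≤ 1/100 → |y| ≤ 10*s^2 → |x*y| ≤ s^2 := by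
      intro x y hx hy
      rw [abs_mul]
      nlinarith [abs_nonneg x, abs_nonneg y]
    have small : ∀ x : ℝ, |x| ≤ 10*s^2 → |x| ≤ 1/100 := fun x hx => by linarith
    have hsa : |s| ≤ 1/100 := by rw [abs_of_pos hs0]; linarith
    have h₁ := abs_le.1 (key s α hsa hα)
    have h₂ := abs_le.1 (key s β hsa hβ)
    have h₃ := abs_le.1 (key s γ hsa hγ)
    have h₄ := abs_le.1 (key α β (small α hα) hβ)
    have h₅ := abs_le.1 (key α γ (small α hα) hγ)
    have h₆ := abs_le.1 (key β γ (small β hβ) hγ)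
    have h₇ := abs_le.1 (key α α (small α hα) hα)
    have h₈ := abs_le.1 (key β β (small β hβ) hβ)
    have h₉ := abs_le.1 (key γ γ (small γ hγ) hγ)
    rw [hqdef, haα, hbβ, hcγ, abs_le]
    constructor <;> linarith
  have hqb' := abs_le.1 hqb
  have hp2 : p^2 ≤ 9*s^2 := by
    have h : |p| ≤ |3*s| := by
      rw [abs_of_pos (by linarith : 0 < 3*s), abs_le]
      constructor <;> linarith
    linarith [sq_le_sq.2 h]
  have hw0 : 0 ≤ q - p^2/4 := by linarith
  have hw : |√(q - p^2/4) - √2*r| ≤ 505*r^3 := by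
    have h2 : (1 : ℝ) ≤ √2 := Real.one_le_sqrt.2 (by norm_num)
    have hpos : 0 < √2*r := by positivity
    refine (abs_sqrt_sub_le hw0 hpos).trans ((div_le_iff₀ hpos).2 ?_)
    have hsq : (√2*r)^2 = 2*s := by rw [mul_pow, Real.sq_sqrt (by norm_num), hs]
    have h4 : 505*s^2 ≤ 505*r^3*(√2*r) := by
      have : 0 ≤ r^4 * (√2 - 1) := mul_nonneg (by positivity) (by linarith)
      rw [hs]
      linarith
    refine le_trans ?_ h4
    rw [hsq, abs_le]
    constructor <;> linarith [sq_nonneg p]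
  have hr4 : r^4 = s^2 := by rw [hs]; ring
  have hr43 : s^2 ≤ r^3 := by
    have : 0 ≤ r^3 * (1 - r) := mul_nonneg (by positivity) (by linarith)
    linarith
  have hre : |27/20*s - p/2| ≤ 15*r^3 := by
    rw [abs_le]; constructor <;> linarith
  obtain ⟨w, hwdef⟩ : ∃ w, w = √(q - p^2/4) := ⟨_, rfl⟩
  have hwsq : w^2 = q - p^2/4 := by rw [hwdef, Real.sq_sqrt hw0]
  rw [← hwdef] at hw
  have norm_add_I_mul_le : ∀ x y : ℝ, |x| ≤ 15*r^3 → |y| ≤ 505*r^3 →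
      ‖(x : ℂ) + Complex.I * (y : ℂ)‖ ≤ 1000*r^3 := by
    intro x y hx hy
    refine (norm_add_le _ _).trans ?_
    have hr3 : 0 < r^3 := by positivity
    rw [norm_mul, Complex.norm_I, Complex.norm_real, Complex.norm_real, Real.norm_eq_abs,
      Real.norm_eq_abs]
    linarith
  have hs2 : 0 ≤ s^2 := sq_nonneg s
  refine ⟨a, b, c, -(p/2 : ℝ) - Complex.I * w, -(p/2 : ℝ) + Complex.I * w,
    fun z => ?_, ?_, ?_, ?_, ?_, ?_⟩
  · unfold quintic at ha hb hc
    have hfac := quintic_eq_mul_of_roots (c₄ := ((4*s+6 : ℝ) : ℂ))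
      (c₃ := ((3*s^2+23*s+5 : ℝ) : ℂ)) (c₂ := ((11*s^2+28*s : ℝ) : ℂ))
      (c₁ := ((3*s^3+19*s^2+10*s : ℝ) : ℂ)) (c₀ := ((s^3+5*s^2 : ℝ) : ℂ))
      (a := a) (b := b) (c := c)
      (by exact_mod_cast hab.ne) (by exact_mod_cast (hab.trans hbc).ne)
      (by exact_mod_cast hbc.ne) (by exact_mod_cast ha) (by exact_mod_cast hb)
      (by exact_mod_cast hc) z
    have hpC : (p : ℂ) = (4*s+6) + a + b + c := by exact_mod_cast hpdef
    have hqC : (q : ℂ) = (3*s^2+23*s+5) + (4*s+6)*(a+b+c)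
        + (a^2 + b^2 + c^2 + a*b + a*c + b*c) := by exact_mod_cast hqdef
    have hwC : (w : ℂ)^2 = q - p^2/4 := by exact_mod_cast hwsq
    have hsC : (s : ℂ) = r^2 := by exact_mod_cast hs
    push_cast at hfac ⊢
    rw [← hpC, ← hqC] at hfac
    rw [hsC] at hfac
    linear_combination hfac + (z - a) * (z - b) * (z - c) * ((w : ℂ)^2 * Complex.I_sq - hwC)
  · rw [← Complex.ofReal_add, Complex.norm_real, Real.norm_eq_abs, hr4, ← hs, haα,
      show -5 - 11/20*s + α + (5 + 11/20*s) = α by ring]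
    linarith
  · rw [← Complex.ofReal_add, Complex.norm_real, Real.norm_eq_abs, hr4, ← hs, hbβ,
      show -1 - 1/4*s + β + (1 + 1/4*s) = β by ring]
    linarith
  · rw [← Complex.ofReal_add, Complex.norm_real, Real.norm_eq_abs, hr4, ← hs, hcγ,
      show -(1/2)*s + γ + 1/2*s = γ by ring]
    linarith
  · convert norm_add_I_mul_le (27/20*s - p/2) (√2*r - w) hre (by rwa [abs_sub_comm]) using 2
    rw [hs]
    push_cast
    ring
  · convert norm_add_I_mul_le (27/20*s - p/2) (w - √2*r) hre hw using 2
    rw [hs]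
    push_cast
    ring
end
end
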